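/- Let c_1,…,c_N>0 be fixed, let 1≤κ≤2 and μ>0. Then there exists a constant C>0, depending only on κ, μ and c_1,…,c_N, such that the following holds: if G:[0,∞)×ℝ³→ℝ is smooth and u is a smooth solution of ∂_t²u−Δ_x u=G on (0,∞)×ℝ³ with u(0,·)=0 and ∂_t u(0,·)=0, then for every t>0, every r≥1, and every unit vector ω∈S², setting v(t,r,ω)=r·u(t,rω), one has |(∂_t+∂_r)v(t,r,ω)| ≤ C·⟨t+r⟩^{−κ}·log(2+t+r)·A_{κ,μ,2}[G;1](t,rω), where ∂_r on the left denotes differentiation of v in the radial variable r. -/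

import Mathlib

noncomputable section

namespace PaperKatayama

/-- Euclidean 3-space. -/
abbrev E3 := EuclideanSpace ℝ (Fin 3)

/-- Space-time functions. -/
abbrev Fn := ℝ → E3 → ℝ

/-- Functions of the space variable alone. -/
abbrev SFn := E3 → ℝ

/-- The Japanese bracket `⟨a⟩ = √(1+a²)`. -/
def jb (a : ℝ) : ℝ := Real.sqrt (1 + a ^ 2)

/-- Time derivative `∂_t`. -/
def pt (f : Fn) : Fn := fun t x => deriv (fun s => f s x) t

/-- Spatial derivative `∂_j` (j = 1,2,3, here indexed by `Fin 3`). -/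
def pd (j : Fin 3) (f : Fn) : Fn :=
  fun t x => fderiv ℝ (f t) x (EuclideanSpace.single j 1)

/-- `∂_a` for `a ∈ {0,1,2,3}`, with `∂_0 = ∂_t`. -/
def pda (a : Fin 4) : Fn → Fn := Fin.cases pt (fun j => pd j) a

/-- Rotation field `Ω_{jk} = x_j ∂_k − x_k ∂_j`, extended antisymmetrically
(so `rotA k j = − rotA j k`, and `rotA j j = 0`). -/
def rotA (j k : Fin 3) (f : Fn) : Fn :=
  fun t x => x j * pd k f t x - x k * pd j f t x

/-- Radial derivative `∂_r = Σ_j (x_j/r) ∂_j`. -/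
def pr (f : Fn) : Fn := fun t x => ∑ j, (x j / ‖x‖) * pd j f t x

/-- `D_{+,c} = ∂_t + c ∂_r`. -/
def Dp (c : ℝ) (f : Fn) : Fn := fun t x => pt f t x + c * pr f t x

/-- `D_{−,c} = ∂_t − c ∂_r`. -/
def Dm (c : ℝ) (f : Fn) : Fn := fun t x => pt f t x - c * pr f t x

/-- The seven fields `Z = {∂_t, ∂_1, ∂_2, ∂_3, Ω_{12}, Ω_{13}, Ω_{23}}`. -/
def Zop : Fin 7 → Fn → Fn :=
  ![pt, pd 0, pd 1, pd 2, rotA 0 1, rotA 0 2, rotA 1 2]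

/-- `Z^α = Z_1^{α_1} ⋯ Z_7^{α_7}`. -/
def Zpow (α : Fin 7 → ℕ) (f : Fn) : Fn :=
  (Zop 0)^[α 0] <| (Zop 1)^[α 1] <| (Zop 2)^[α 2] <| (Zop 3)^[α 3] <|
    (Zop 4)^[α 4] <| (Zop 5)^[α 5] <| (Zop 6)^[α 6] f

/-- Multi-indices `α` (for the seven fields) with `|α| ≤ s`. -/
def multiIdx (s : ℕ) : Finset (Fin 7 → ℕ) :=
  (Fintype.piFinset fun _ => Finset.range (s + 1)).filter fun α => ∑ i, α i ≤ s

/-- `|v(t,x)|_s = Σ_{|α| ≤ s} |Z^α v(t,x)|`. -/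
def vnorm (s : ℕ) (f : Fn) (t : ℝ) (x : E3) : ℝ :=
  ∑ α ∈ multiIdx s, |Zpow α f t x|

/-- Smoothness of a space-time function. -/
def Smooth (f : Fn) : Prop := ContDiff ℝ (⊤ : ℕ∞) (fun p : ℝ × E3 => f p.1 p.2)

/-- `u` is a smooth solution of `∂_t²u − c²Δu = G` on `(0,∞)×ℝ³`
with zero initial data. -/
def IsWaveSol (c : ℝ) (G u : Fn) : Prop :=
  Smooth u ∧
    (∀ t x, 0 < t → pt (pt u) t x - c ^ 2 * ∑ j, pd j (pd j u) t x = G t x) ∧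
    (∀ x, u 0 x = 0) ∧ (∀ x, pt u 0 x = 0)

/-- `u` is a smooth solution of the free wave equation `∂_t²u − c²Δu = 0`
on `(0,∞)×ℝ³` with initial data `φ, ψ`. -/
def IsFreeWaveSol (c : ℝ) (φ ψ : SFn) (u : Fn) : Prop :=
  Smooth u ∧
    (∀ t x, 0 < t → pt (pt u) t x - c ^ 2 * ∑ j, pd j (pd j u) t x = 0) ∧
    (∀ x, u 0 x = φ x) ∧ (∀ x, pt u 0 x = ψ x)

/-- Extension of the speeds `c_1, …, c_N` by `c_0 = 0`. -/
def cs0 {N : ℕ} (cs : Fin N → ℝ) : Fin (N + 1) → ℝ := Fin.cases 0 cs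

/-- The weight `w(t,r) = min_{0 ≤ j ≤ N} ⟨c_j t − r⟩` (with `c_0 = 0`). -/
def wgt {N : ℕ} (cs : Fin N → ℝ) (t r : ℝ) : ℝ :=
  Finset.univ.inf' Finset.univ_nonempty fun j : Fin (N + 1) => jb (cs0 cs j * t - r)

/-- The weighted sup `A_{ρ,μ,s}[G;c](t,x)` over the backward cone `Λ_c(t,x)`. -/
def Afun (ρ μ : ℝ) (s : ℕ) (G : Fn) (c : ℝ) {N : ℕ} (cs : Fin N → ℝ)
    (t : ℝ) (x : E3) : ℝ :=
  sSup {a : ℝ | ∃ τ : ℝ, ∃ y : E3, 0 ≤ τ ∧ τ ≤ t ∧ ‖y - x‖ ≤ c * (t - τ) ∧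
    a = ‖y‖ * jb (τ + ‖y‖) ^ ρ * wgt cs τ ‖y‖ ^ (1 + μ) * vnorm s G τ y}

/-- Spatial derivative of a function of `x` alone. -/
def sd (j : Fin 3) (φ : SFn) : SFn :=
  fun x => fderiv ℝ φ x (EuclideanSpace.single j 1)

/-- Spatial rotation field for functions of `x` alone. -/
def srot (j k : Fin 3) (φ : SFn) : SFn :=
  fun x => x j * sd k φ x - x k * sd j φ x

/-- The six spatial fields `{∂_1, ∂_2, ∂_3, Ω_{12}, Ω_{13}, Ω_{23}}`. -/
def Sop : Fin 6 → SFn → SFn :=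
  ![sd 0, sd 1, sd 2, srot 0 1, srot 0 2, srot 1 2]

/-- `Z^α` for the spatial fields. -/
def Spow (α : Fin 6 → ℕ) (φ : SFn) : SFn :=
  (Sop 0)^[α 0] <| (Sop 1)^[α 1] <| (Sop 2)^[α 2] <| (Sop 3)^[α 3] <|
    (Sop 4)^[α 4] <| (Sop 5)^[α 5] φ

/-- Spatial multi-indices with `|α| ≤ s`. -/
def smultiIdx (s : ℕ) : Finset (Fin 6 → ℕ) :=
  (Fintype.piFinset fun _ => Finset.range (s + 1)).filter fun α => ∑ i, α i ≤ s

/-- `|φ(x)|_s` for a function of `x` alone. -/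
def snorm (s : ℕ) (φ : SFn) (x : E3) : ℝ :=
  ∑ α ∈ smultiIdx s, |Spow α φ x|

/-- The weighted sup `B_{ρ,s}[φ,ψ;c](t,x)`. -/
def Bfun (ρ : ℝ) (s : ℕ) (φ ψ : SFn) (c t : ℝ) (x : E3) : ℝ :=
  sSup {b : ℝ | ∃ y : E3, ‖y - x‖ ≤ c * t ∧
    b = jb ‖y‖ ^ ρ * (snorm (s + 1) φ y + snorm s ψ y)}

/-- `Φ_ρ(t,r)`. -/
def Phi (ρ t r : ℝ) : ℝ :=
  if ρ = 0 then Real.log (2 + jb (t + r) / jb (t - r)) else jb (t - r) ^ (-ρ)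

/-- `Ψ_ρ(t)`. -/
def Psi (ρ t : ℝ) : ℝ := if ρ = 0 then Real.log (2 + t) else 1

/-- The null form `Q_0(v,w;c) = (∂_t v)(∂_t w) − c²(∇v)·(∇w)`. -/
def Q0f (c : ℝ) (v w : Fn) : Fn :=
  fun t x => pt v t x * pt w t x - c ^ 2 * ∑ j, pd j v t x * pd j w t x

/-- The null form `Q_{ab}(v,w) = (∂_a v)(∂_b w) − (∂_b v)(∂_a w)`. -/
def Qab (a b : Fin 4) (v w : Fn) : Fn :=
  fun t x => pda a v t x * pda b w t x - pda b v t x * pda a w t x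

/-- Lorentz boost `L_{c,j} = (x_j/c)∂_t + c t ∂_j`. -/
def Lb (c : ℝ) (j : Fin 3) (f : Fn) : Fn :=
  fun t x => (x j / c) * pt f t x + c * t * pd j f t x

/-- Scaling field `S = t ∂_t + x·∇_x`. -/
def Sc (f : Fn) : Fn := fun t x => t * pt f t x + ∑ j, x j * pd j f t x

/-- `v(t,r,ω) = r u(t, rω)`. -/
def Vrad (u : Fn) (ω : E3) (t r : ℝ) : ℝ := r * u t (r • ω)

/-- `(∂_t + ∂_r) v` in the variables `(t,r)` for fixed `ω`. -/
def DpV (u : Fn) (ω : E3) (t r : ℝ) : ℝ :=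
  deriv (fun s => Vrad u ω s r) t + deriv (fun ρ' => Vrad u ω t ρ') r

/-- Cross product in ℝ³. -/
def cross3 (a b : Fin 3 → ℝ) : Fin 3 → ℝ :=
  ![a 1 * b 2 - a 2 * b 1, a 2 * b 0 - a 0 * b 2, a 0 * b 1 - a 1 * b 0]

/-- `Ωv = (Ω_{23}v, −Ω_{13}v, Ω_{12}v)`. -/
def OmegaVec (v : Fn) (t : ℝ) (x : E3) : Fin 3 → ℝ :=
  ![rotA 1 2 v t x, -(rotA 0 2 v t x), rotA 0 1 v t x]

/-- `∂^α` for a multi-index with `|α| ≤ 1`: either the identity or a single `∂_a`. -/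
def Dle1 : Option (Fin 4) → Fn → Fn
  | none => id
  | some a => pda a

/-- A linear combination, with constant real coefficients, of the null forms
`Q_0(u_j, ∂^α u_k; c)` and `Q_{ab}(u_j, ∂^α u_k)` with `0 ≤ a < b ≤ 3`, `|α| ≤ 1`. -/
def NullF (c : ℝ) (m : ℕ)
    (a0 : Fin m → Fin m → Fin m → Option (Fin 4) → ℝ)
    (aQ : Fin m → Fin m → Fin m → Fin 4 → Fin 4 → Option (Fin 4) → ℝ)
    (v : Fin m → Fn) (i : Fin m) : Fn := fun t x =>
  (∑ j, ∑ k, ∑ o : Option (Fin 4), a0 i j k o * Q0f c (v j) (Dle1 o (v k)) t x) +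
    ∑ j, ∑ k, ∑ p ∈ Finset.univ.filter (fun p : Fin 4 × Fin 4 => p.1 < p.2),
      ∑ o : Option (Fin 4), aQ i j k p.1 p.2 o * Qab p.1 p.2 (v j) (Dle1 o (v k)) t x

section Aux

open scoped ContDiff
open MeasureTheory Real

/-- A space-time function as a function of one variable. -/
def un (f : Fn) : ℝ × E3 → ℝ := fun p => f p.1 p.2

/-- Directional derivative of a function on space-time. -/
def dd (v : ℝ × E3) (F : ℝ × E3 → ℝ) : ℝ × E3 → ℝ := fun p => fderiv ℝ F p v

/-- The spatial unit vector `e_j`, as a space-time vector. -/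
def sv (j : Fin 3) : ℝ × E3 := (0, EuclideanSpace.single j 1)

/-- The time unit vector. -/
def tv : ℝ × E3 := (1, 0)

/-- The rotation field on functions of one space-time variable. -/
def rot (j k : Fin 3) (F : ℝ × E3 → ℝ) : ℝ × E3 → ℝ :=
  fun p => p.2 j * dd (sv k) F p - p.2 k * dd (sv j) F p

/-- The wave operator. -/
def box (F : ℝ × E3 → ℝ) : ℝ × E3 → ℝ :=
  fun p => dd tv (dd tv F) p - ∑ j, dd (sv j) (dd (sv j) F) p

lemma contDiff_dd {F : ℝ × E3 → ℝ} (hF : ContDiff ℝ ∞ F) (v : ℝ × E3) :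
    ContDiff ℝ ∞ (dd v F) :=
  (hF.fderiv_right (m := ∞) (by simp)).clm_apply contDiff_const

lemma contDiff_coord (j : Fin 3) : ContDiff ℝ ∞ (fun p : ℝ × E3 => p.2 j) := by
  fun_prop

lemma contDiff_rot {F : ℝ × E3 → ℝ} (hF : ContDiff ℝ ∞ F) (j k : Fin 3) :
    ContDiff ℝ ∞ (rot j k F) :=
  ((contDiff_coord j).mul (contDiff_dd hF _)).sub ((contDiff_coord k).mul (contDiff_dd hF _))

lemma un_pt {f : Fn} (hf : Smooth f) : un (pt f) = dd tv (un f) := by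
  funext p
  have hd : DifferentiableAt ℝ (un f) p := (ContDiff.differentiable hf (by simp)) p
  have h1 : HasDerivAt (fun s : ℝ => ((s, p.2) : ℝ × E3)) ((1 : ℝ), (0 : E3)) p.1 :=
    (hasDerivAt_id p.1).prodMk (hasDerivAt_const _ _)
  exact (hd.hasFDerivAt.comp_hasDerivAt p.1 h1).deriv

lemma un_pd {f : Fn} (hf : Smooth f) (j : Fin 3) : un (pd j f) = dd (sv j) (un f) := by
  funext p
  have hd : DifferentiableAt ℝ (un f) p := (ContDiff.differentiable hf (by simp)) p
  have h1 : HasFDerivAt (fun y : E3 => ((p.1, y) : ℝ × E3))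
      (ContinuousLinearMap.inr ℝ ℝ E3) p.2 := hasFDerivAt_prodMk_right _ _
  have h2 : HasFDerivAt (f p.1) ((fderiv ℝ (un f) p).comp (ContinuousLinearMap.inr ℝ ℝ E3)) p.2 :=
    HasFDerivAt.comp (f := fun y : E3 => ((p.1, y) : ℝ × E3)) (g := un f) p.2 hd.hasFDerivAt h1
  simp only [un, pd, dd, sv]
  rw [h2.fderiv]
  rfl

lemma un_rotA {f : Fn} (hf : Smooth f) (j k : Fin 3) : un (rotA j k f) = rot j k (un f) := by
  have h1 := un_pd hf j
  have h2 := un_pd hf k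
  funext p
  simp only [rot, ← h1, ← h2]
  rfl

lemma smooth_pt {f : Fn} (hf : Smooth f) : Smooth (pt f) := by
  have : ContDiff ℝ ∞ (un (pt f)) := by rw [un_pt hf]; exact contDiff_dd hf _
  exact this

lemma smooth_pd {f : Fn} (hf : Smooth f) (j : Fin 3) : Smooth (pd j f) := by
  have : ContDiff ℝ ∞ (un (pd j f)) := by rw [un_pd hf]; exact contDiff_dd hf _
  exact this

lemma smooth_rotA {f : Fn} (hf : Smooth f) (j k : Fin 3) : Smooth (rotA j k f) := by
  have : ContDiff ℝ ∞ (un (rotA j k f)) := by rw [un_rotA hf]; exact contDiff_rot hf _ _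
  exact this

lemma smooth_Zop {f : Fn} (hf : Smooth f) (i : Fin 7) : Smooth (Zop i f) := by
  fin_cases i
  exacts [smooth_pt hf, smooth_pd hf 0, smooth_pd hf 1, smooth_pd hf 2,
    smooth_rotA hf 0 1, smooth_rotA hf 0 2, smooth_rotA hf 1 2]

lemma smooth_Zop_iterate {f : Fn} (hf : Smooth f) (i : Fin 7) (n : ℕ) :
    Smooth ((Zop i)^[n] f) := by
  induction n with
  | zero => exact hf
  | succ n ih => rw [Function.iterate_succ_apply']; exact smooth_Zop ih i

lemma smooth_Zpow {f : Fn} (hf : Smooth f) (α : Fin 7 → ℕ) : Smooth (Zpow α f) := by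
  unfold Zpow
  iterate 7 apply smooth_Zop_iterate
  exact hf

lemma fderiv_dd {F : ℝ × E3 → ℝ} (hF : ContDiff ℝ ∞ F) (v w p : ℝ × E3) :
    dd w (dd v F) p = fderiv ℝ (fderiv ℝ F) p w v := by
  have h : DifferentiableAt ℝ (fderiv ℝ F) p :=
    ((hF.fderiv_right (m := ∞) (by simp)).differentiable (by simp)) p
  have := h.hasFDerivAt.clm_apply (hasFDerivAt_const v p)
  unfold dd
  rw [this.fderiv]
  simp

lemma fderiv_fderiv_comm {F : ℝ × E3 → ℝ} (hF : ContDiff ℝ ∞ F) (v w p : ℝ × E3) :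
    fderiv ℝ (fderiv ℝ F) p v w = fderiv ℝ (fderiv ℝ F) p w v := by
  have := (hF.contDiffAt (x := p)).isSymmSndFDerivAt
    (by simpa using WithTop.coe_le_coe.2 (le_top : (2 : ℕ∞) ≤ ⊤))
  exact this v w

lemma dd_comm {F : ℝ × E3 → ℝ} (hF : ContDiff ℝ ∞ F) (v w : ℝ × E3) :
    dd w (dd v F) = dd v (dd w F) := by
  funext p
  rw [fderiv_dd hF, fderiv_dd hF, fderiv_fderiv_comm hF]

lemma dd_coord_mul {F : ℝ × E3 → ℝ} (hF : ContDiff ℝ ∞ F) (v p : ℝ × E3) (j : Fin 3) :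
    dd v (fun q => q.2 j * F q) p = v.2 j * F p + p.2 j * dd v F p := by
  have h1 : HasFDerivAt (fun q : ℝ × E3 => q.2 j)
      ((EuclideanSpace.proj j : E3 →L[ℝ] ℝ).comp (ContinuousLinearMap.snd ℝ ℝ E3)) p :=
    ((EuclideanSpace.proj j : E3 →L[ℝ] ℝ).comp (ContinuousLinearMap.snd ℝ ℝ E3)).hasFDerivAt
  have h2 := (hF.differentiable (by simp) p).hasFDerivAt
  have h3 : HasFDerivAt (fun q : ℝ × E3 => q.2 j * F q) _ p := h1.mul h2
  unfold dd
  rw [h3.fderiv]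
  simp
  ring

lemma dd_sub {F G : ℝ × E3 → ℝ} (hF : ContDiff ℝ ∞ F) (hG : ContDiff ℝ ∞ G) (v p : ℝ × E3) :
    dd v (fun q => F q - G q) p = dd v F p - dd v G p := by
  unfold dd
  rw [fderiv_fun_sub (hF.differentiable (by simp) p) (hG.differentiable (by simp) p)]
  simp

lemma dd_add {F G : ℝ × E3 → ℝ} (hF : ContDiff ℝ ∞ F) (hG : ContDiff ℝ ∞ G) (v p : ℝ × E3) :
    dd v (fun q => F q + G q) p = dd v F p + dd v G p := by
  unfold dd
  rw [fderiv_fun_add (hF.differentiable (by simp) p) (hG.differentiable (by simp) p)]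
  simp

lemma dd_const_mul {F : ℝ × E3 → ℝ} (hF : ContDiff ℝ ∞ F) (c : ℝ) (v p : ℝ × E3) :
    dd v (fun q => c * F q) p = c * dd v F p := by
  unfold dd
  rw [fderiv_const_mul (hF.differentiable (by simp) p)]
  simp

lemma dd_rot {F : ℝ × E3 → ℝ} (hF : ContDiff ℝ ∞ F) (v : ℝ × E3) (j k : Fin 3) :
    dd v (rot j k F) = fun p => rot j k (dd v F) p
      + (v.2 j * dd (sv k) F p - v.2 k * dd (sv j) F p) := by
  funext p
  unfold rot
  rw [dd_sub ((contDiff_coord j).mul (contDiff_dd hF _))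
    ((contDiff_coord k).mul (contDiff_dd hF _)), dd_coord_mul (contDiff_dd hF _),
    dd_coord_mul (contDiff_dd hF _), dd_comm hF v, dd_comm hF v]
  ring

lemma box_rot {F : ℝ × E3 → ℝ} (hF : ContDiff ℝ ∞ F) (j k : Fin 3) :
    box (rot j k F) = rot j k (box F) := by
  have h2 : ∀ v p, dd v (dd v (rot j k F)) p = rot j k (dd v (dd v F)) p
      + 2 * (v.2 j * dd (sv k) (dd v F) p - v.2 k * dd (sv j) (dd v F) p) := by
    intro v p
    have hv := contDiff_dd hF v
    rw [dd_rot hF, dd_add (contDiff_rot hv _ _)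
      ((contDiff_const.mul (contDiff_dd hF _)).sub (contDiff_const.mul (contDiff_dd hF _))),
      dd_sub (contDiff_const.mul (contDiff_dd hF _)) (contDiff_const.mul (contDiff_dd hF _)),
      dd_const_mul (contDiff_dd hF _), dd_const_mul (contDiff_dd hF _), dd_rot hv,
      dd_comm hF (sv j) v, dd_comm hF (sv k) v]
    ring
  have hb : ∀ v p, dd v (box F) p = dd v (dd tv (dd tv F)) p
      - ∑ i, dd v (dd (sv i) (dd (sv i) F)) p := by
    intro v p
    have hs : ∀ i, ContDiff ℝ ∞ (dd (sv i) (dd (sv i) F)) :=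
      fun i => contDiff_dd (contDiff_dd hF _) _
    have e : box F = fun p => dd tv (dd tv F) p - (dd (sv 0) (dd (sv 0) F) p
        + dd (sv 1) (dd (sv 1) F) p + dd (sv 2) (dd (sv 2) F) p) := by
      funext p; simp [box, Fin.sum_univ_three]
    rw [e, dd_sub (contDiff_dd (contDiff_dd hF _) _) (((hs 0).add (hs 1)).add (hs 2)),
      dd_add ((hs 0).add (hs 1)) (hs 2), dd_add (hs 0) (hs 1), Fin.sum_univ_three]
  funext p
  have c : dd (sv j) (dd (sv k) F) p = dd (sv k) (dd (sv j) F) p := by rw [dd_comm hF]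
  have s1 : ∀ (i l : Fin 3), (sv i).2 l = if l = i then 1 else 0 := by
    intro i l; simp [sv]
  have s2 : ∀ l : Fin 3, (tv).2 l = 0 := by intro l; simp [tv]
  have hr : rot j k (box F) p = rot j k (dd tv (dd tv F)) p
      - ∑ i, rot j k (dd (sv i) (dd (sv i) F)) p := by
    simp only [rot, hb, Finset.mul_sum, mul_sub, Finset.sum_sub_distrib]
    ring
  rw [hr]
  unfold box
  simp only [h2, s1, s2, Finset.sum_add_distrib, Finset.sum_sub_distrib, ← Finset.mul_sum,
    ite_mul, one_mul, zero_mul, Finset.sum_ite_eq, Finset.mem_univ, if_true]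
  rw [c]
  ring

lemma sum_sv_eq_sum_basis (B : (ℝ × E3) →L[ℝ] (ℝ × E3) →L[ℝ] ℝ)
    (b : OrthonormalBasis (Fin 3) ℝ E3) :
    ∑ j, B (sv j) (sv j) = ∑ i, B (0, b i) (0, b i) := by
  have hb : ∀ i, ((0 : ℝ), b i) = ∑ j, (b i) j • sv j := by
    intro i
    have h : b i = ∑ j, (b i) j • EuclideanSpace.single j (1 : ℝ) := by
      ext l; simp [Finset.sum_apply, Pi.single_apply]
    conv_lhs => rw [h]
    ext1
    · simp [sv, Prod.fst_sum]
    · simp [sv, Prod.snd_sum]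
  have hδ : ∀ j k : Fin 3, ∑ i, (b i) j * (b i) k = if j = k then 1 else 0 := by
    intro j k
    have := b.sum_inner_mul_inner (EuclideanSpace.single j (1 : ℝ)) (EuclideanSpace.single k 1)
    simpa [EuclideanSpace.inner_single_left, EuclideanSpace.inner_single_right, eq_comm] using this
  have : ∀ i, B (0, b i) (0, b i) = ∑ j, ∑ k, ((b i) j * (b i) k) * B (sv j) (sv k) := by
    intro i
    rw [hb i]
    simp only [map_sum, map_smul, sum_apply, smul_apply,
      smul_eq_mul, Finset.mul_sum]
    rw [Finset.sum_comm]
    exact Finset.sum_congr rfl fun j _ => Finset.sum_congr rfl fun k _ => by ring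
  simp only [this]
  rw [Finset.sum_comm]
  refine Finset.sum_congr rfl fun j _ => ?_
  rw [Finset.sum_comm]
  simp only [← Finset.sum_mul, hδ]
  simp

lemma box_eq {F : ℝ × E3 → ℝ} (hF : ContDiff ℝ ∞ F) (b : OrthonormalBasis (Fin 3) ℝ E3)
    (p : ℝ × E3) :
    box F p = fderiv ℝ (fderiv ℝ F) p (1, 0) (1, 0)
      - ∑ i, fderiv ℝ (fderiv ℝ F) p (0, b i) (0, b i) := by
  rw [← sum_sv_eq_sum_basis]
  simp only [box, fderiv_dd hF]
  rfl

lemma hasDerivAt_comp_curve {F : ℝ × E3 → ℝ} (hF : ContDiff ℝ ∞ F) {c : ℝ → ℝ × E3}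
    {c' : ℝ × E3} {s : ℝ} (hc : HasDerivAt c c' s) :
    HasDerivAt (fun s => F (c s)) (fderiv ℝ F (c s) c') s :=
  (hF.differentiable (by simp) _).hasFDerivAt.comp_hasDerivAt s hc

lemma hasDerivAt_fderiv_curve {F : ℝ × E3 → ℝ} (hF : ContDiff ℝ ∞ F) {c V : ℝ → ℝ × E3}
    {c' V' : ℝ × E3} {s : ℝ} (hc : HasDerivAt c c' s) (hV : HasDerivAt V V' s) :
    HasDerivAt (fun s => fderiv ℝ F (c s) (V s))
      (fderiv ℝ (fderiv ℝ F) (c s) c' (V s) + fderiv ℝ F (c s) V') s := by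
  have h1 : HasDerivAt (fun s => fderiv ℝ F (c s)) (fderiv ℝ (fderiv ℝ F) (c s) c') s :=
    (((hF.fderiv_right (m := ∞) (by simp)).differentiable
      (by simp)) _).hasFDerivAt.comp_hasDerivAt s hc
  exact h1.clm_apply hV

/-- Transport quantity `(∂_t + ∂_ρ)(ρ F)` along a backward null ray. -/
def rayQ (F : ℝ × E3 → ℝ) (t : ℝ) (x w : E3) (ρ : ℝ) : ℝ :=
  F (t - ρ, x + ρ • w) + ρ * fderiv ℝ F (t - ρ, x + ρ • w) (1, w)

/-- The derivative of `rayQ`. -/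
def rayQ' (F : ℝ × E3 → ℝ) (t : ℝ) (x w : E3) (ρ : ℝ) : ℝ :=
  2 * fderiv ℝ F (t - ρ, x + ρ • w) (0, w)
    + ρ * (fderiv ℝ (fderiv ℝ F) (t - ρ, x + ρ • w) (0, w) (0, w)
      - fderiv ℝ (fderiv ℝ F) (t - ρ, x + ρ • w) (1, 0) (1, 0))

lemma hasDerivAt_rayQ {F : ℝ × E3 → ℝ} (hF : ContDiff ℝ ∞ F) (t : ℝ) (x w : E3) (ρ : ℝ) :
    HasDerivAt (rayQ F t x w) (rayQ' F t x w ρ) ρ := by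
  have hc : HasDerivAt (fun ρ : ℝ => (t - ρ, x + ρ • w)) ((-1 : ℝ), w) ρ := by
    refine HasDerivAt.prodMk ?_ ?_
    · simpa using (hasDerivAt_id ρ).const_sub t
    · simpa using ((hasDerivAt_id ρ).smul_const w).const_add x
  have h := (hasDerivAt_comp_curve hF hc).add
    ((hasDerivAt_id ρ).mul (hasDerivAt_fderiv_curve hF hc (hasDerivAt_const ρ ((1 : ℝ), w))))
  refine h.congr_deriv ?_
  have e1 : ((-1 : ℝ), w) = (0, w) - (1, 0) := by ext <;> simp
  have e2 : ((1 : ℝ), w) = (0, w) + (1, 0) := by ext <;> simp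
  simp only [rayQ', e1, e2, map_add, map_sub, sub_apply, id,
    fderiv_fderiv_comm hF (1, 0) (0, w), map_zero]
  ring

/-- Spherical coordinates with respect to an orthonormal basis. -/
def sph (b : OrthonormalBasis (Fin 3) ℝ E3) (θ φ : ℝ) : E3 :=
  cos θ • b 0 + sin θ • (cos φ • b 1 + sin φ • b 2)

/-- The unit vector in the direction of increasing polar angle. -/
def sphT (b : OrthonormalBasis (Fin 3) ℝ E3) (θ φ : ℝ) : E3 :=
  (-sin θ) • b 0 + cos θ • (cos φ • b 1 + sin φ • b 2)

/-- The unit vector in the direction of increasing azimuth. -/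
def sphN (b : OrthonormalBasis (Fin 3) ℝ E3) (φ : ℝ) : E3 :=
  (-sin φ) • b 1 + cos φ • b 2

lemma hasDerivAt_sph_polar (b : OrthonormalBasis (Fin 3) ℝ E3) (θ φ : ℝ) :
    HasDerivAt (fun θ => sph b θ φ) (sphT b θ φ) θ :=
  ((hasDerivAt_cos θ).smul_const _).add ((hasDerivAt_sin θ).smul_const _)

lemma hasDerivAt_sphT_polar (b : OrthonormalBasis (Fin 3) ℝ E3) (θ φ : ℝ) :
    HasDerivAt (fun θ => sphT b θ φ) (-sph b θ φ) θ := by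
  have := ((hasDerivAt_sin θ).neg.smul_const (b 0)).add
    ((hasDerivAt_cos θ).smul_const (cos φ • b 1 + sin φ • b 2))
  refine this.congr_deriv ?_
  simp only [sph]; module

lemma hasDerivAt_sph_azimuth (b : OrthonormalBasis (Fin 3) ℝ E3) (θ φ : ℝ) :
    HasDerivAt (fun φ => sph b θ φ) (sin θ • sphN b φ) φ :=
  ((((hasDerivAt_cos φ).smul_const _).add
    ((hasDerivAt_sin φ).smul_const _)).const_smul (sin θ)).const_add _

lemma hasDerivAt_sphN (b : OrthonormalBasis (Fin 3) ℝ E3) (θ φ : ℝ) :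
    HasDerivAt (sphN b) (-(sin θ • sph b θ φ + cos θ • sphT b θ φ)) φ := by
  have := ((hasDerivAt_sin φ).neg.smul_const (b 1)).add ((hasDerivAt_cos φ).smul_const (b 2))
  refine this.congr_deriv ?_
  simp only [sph, sphT]
  have h := sin_sq_add_cos_sq θ
  match_scalars
  · linear_combination cos φ * h
  · linear_combination sin φ * h
  · ring

lemma sum_basis_eq_frame (B : (ℝ × E3) →L[ℝ] (ℝ × E3) →L[ℝ] ℝ)
    (b : OrthonormalBasis (Fin 3) ℝ E3) (θ φ : ℝ) :
    ∑ i, B (0, b i) (0, b i) = B (0, sph b θ φ) (0, sph b θ φ) +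
      B (0, sphT b θ φ) (0, sphT b θ φ) + B (0, sphN b φ) (0, sphN b φ) := by
  have e1 : ((0 : ℝ), sph b θ φ) = cos θ • (0, b 0) + sin θ • (cos φ • (0, b 1) + sin φ • (0, b 2)) := by
    ext1 <;> simp [sph]
  have e2 : ((0 : ℝ), sphT b θ φ) =
      (-sin θ) • (0, b 0) + cos θ • (cos φ • (0, b 1) + sin φ • (0, b 2)) := by
    ext1 <;> simp [sphT]
  have e3 : ((0 : ℝ), sphN b φ) = (-sin φ) • (0, b 1) + cos φ • (0, b 2) := by
    ext1 <;> simp [sphN]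
  rw [e1, e2, e3, Fin.sum_univ_three]
  simp only [map_add, map_smul, add_apply, smul_apply,
    smul_eq_mul]
  have h1 := cos_sq' θ
  have h2 := cos_sq' φ
  ring_nf
  simp only [h1, h2]
  ring

/-- A point on a backward null ray in spherical coordinates. -/
def rayP (b : OrthonormalBasis (Fin 3) ℝ E3) (t : ℝ) (x : E3) (ρ θ φ : ℝ) : ℝ × E3 :=
  (t - ρ, x + ρ • sph b θ φ)

/-- Polar flux. -/
def fluxT (F : ℝ × E3 → ℝ) (b : OrthonormalBasis (Fin 3) ℝ E3) (t : ℝ) (x : E3)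
    (ρ θ φ : ℝ) : ℝ :=
  sin θ * fderiv ℝ F (rayP b t x ρ θ φ) (0, sphT b θ φ)

/-- Derivative of the polar flux. -/
def fluxT' (F : ℝ × E3 → ℝ) (b : OrthonormalBasis (Fin 3) ℝ E3) (t : ℝ) (x : E3)
    (ρ θ φ : ℝ) : ℝ :=
  cos θ * fderiv ℝ F (rayP b t x ρ θ φ) (0, sphT b θ φ) + sin θ *
    (ρ * fderiv ℝ (fderiv ℝ F) (rayP b t x ρ θ φ) (0, sphT b θ φ) (0, sphT b θ φ)
      - fderiv ℝ F (rayP b t x ρ θ φ) (0, sph b θ φ))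

/-- Azimuthal flux. -/
def fluxN (F : ℝ × E3 → ℝ) (b : OrthonormalBasis (Fin 3) ℝ E3) (t : ℝ) (x : E3)
    (ρ θ φ : ℝ) : ℝ :=
  fderiv ℝ F (rayP b t x ρ θ φ) (0, sphN b φ)

/-- Derivative of the azimuthal flux. -/
def fluxN' (F : ℝ × E3 → ℝ) (b : OrthonormalBasis (Fin 3) ℝ E3) (t : ℝ) (x : E3)
    (ρ θ φ : ℝ) : ℝ :=
  ρ * sin θ * fderiv ℝ (fderiv ℝ F) (rayP b t x ρ θ φ) (0, sphN b φ) (0, sphN b φ)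
    - (sin θ * fderiv ℝ F (rayP b t x ρ θ φ) (0, sph b θ φ)
      + cos θ * fderiv ℝ F (rayP b t x ρ θ φ) (0, sphT b θ φ))

lemma hasDerivAt_fluxT {F : ℝ × E3 → ℝ} (hF : ContDiff ℝ ∞ F)
    (b : OrthonormalBasis (Fin 3) ℝ E3) (t : ℝ) (x : E3) (ρ θ φ : ℝ) :
    HasDerivAt (fun θ => fluxT F b t x ρ θ φ) (fluxT' F b t x ρ θ φ) θ := by
  have hc : HasDerivAt (fun θ => rayP b t x ρ θ φ) (0, ρ • sphT b θ φ) θ :=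
    (hasDerivAt_const _ _).prodMk (((hasDerivAt_sph_polar b θ φ).const_smul ρ).const_add x)
  have hV : HasDerivAt (fun θ => ((0 : ℝ), sphT b θ φ)) (0, -sph b θ φ) θ :=
    (hasDerivAt_const _ _).prodMk (hasDerivAt_sphT_polar b θ φ)
  have h := (hasDerivAt_sin θ).mul (hasDerivAt_fderiv_curve hF hc hV)
  refine h.congr_deriv ?_
  have e1 : ((0 : ℝ), ρ • sphT b θ φ) = ρ • (0, sphT b θ φ) := by ext1 <;> simp
  have e2 : ((0 : ℝ), -sph b θ φ) = -(0, sph b θ φ) := by ext1 <;> simp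
  simp only [fluxT', e1, e2, map_smul, map_neg, smul_apply, smul_eq_mul]
  ring

lemma hasDerivAt_fluxN {F : ℝ × E3 → ℝ} (hF : ContDiff ℝ ∞ F)
    (b : OrthonormalBasis (Fin 3) ℝ E3) (t : ℝ) (x : E3) (ρ θ φ : ℝ) :
    HasDerivAt (fun φ => fluxN F b t x ρ θ φ) (fluxN' F b t x ρ θ φ) φ := by
  have hc : HasDerivAt (fun φ => rayP b t x ρ θ φ) (0, ρ • (sin θ • sphN b φ)) φ :=
    (hasDerivAt_const _ _).prodMk (((hasDerivAt_sph_azimuth b θ φ).const_smul ρ).const_add x)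
  have hV : HasDerivAt (fun φ => ((0 : ℝ), sphN b φ))
      (0, -(sin θ • sph b θ φ + cos θ • sphT b θ φ)) φ :=
    (hasDerivAt_const _ _).prodMk (hasDerivAt_sphN b θ φ)
  have h := hasDerivAt_fderiv_curve hF hc hV
  refine h.congr_deriv ?_
  have e1 : ((0 : ℝ), ρ • (sin θ • sphN b φ)) = ρ • (sin θ • (0, sphN b φ)) := by
    ext1 <;> simp
  have e2 : ((0 : ℝ), -(sin θ • sph b θ φ + cos θ • sphT b θ φ)) =
      -(sin θ • (0, sph b θ φ) + cos θ • (0, sphT b θ φ)) := by ext1 <;> simp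
  simp only [fluxN', e1, e2, map_smul, map_neg, map_add, smul_apply,
    smul_eq_mul]
  ring

/-- Divergence form of the wave operator on the backward cone. -/
lemma box_eq_divergence {F : ℝ × E3 → ℝ} (hF : ContDiff ℝ ∞ F)
    (b : OrthonormalBasis (Fin 3) ℝ E3) (t : ℝ) (x : E3) (ρ θ φ : ℝ) :
    sin θ * (ρ * box F (rayP b t x ρ θ φ)) =
      -(sin θ * rayQ' F t x (sph b θ φ) ρ) - fluxT' F b t x ρ θ φ - fluxN' F b t x ρ θ φ := by
  rw [box_eq hF b, sum_basis_eq_frame _ b θ φ]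
  simp only [rayQ', fluxT', fluxN', rayP]
  ring

lemma continuous_fderiv_of_smooth {F : ℝ × E3 → ℝ} (hF : ContDiff ℝ ∞ F) :
    Continuous (fderiv ℝ F) :=
  (hF.fderiv_right (m := ∞) (by simp)).continuous

lemma continuous_fderiv_fderiv {F : ℝ × E3 → ℝ} (hF : ContDiff ℝ ∞ F) :
    Continuous (fderiv ℝ (fderiv ℝ F)) :=
  ((hF.fderiv_right (m := ∞) (by simp)).fderiv_right (m := ∞) (by simp)).continuous

lemma continuous_sphN (b : OrthonormalBasis (Fin 3) ℝ E3) : Continuous (sphN b) := by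
  unfold sphN; fun_prop

lemma continuous_rayP (b : OrthonormalBasis (Fin 3) ℝ E3) (t : ℝ) (x : E3) :
    Continuous (fun q : ℝ × ℝ × ℝ => rayP b t x q.1 q.2.1 q.2.2) := by
  unfold rayP sph; fun_prop

lemma continuous_rayQ' {F : ℝ × E3 → ℝ} (hF : ContDiff ℝ ∞ F) (t : ℝ) (x : E3) :
    Continuous (fun q : ℝ × E3 => rayQ' F t x q.2 q.1) := by
  have h1 := continuous_fderiv_of_smooth hF
  have h2 := continuous_fderiv_fderiv hF
  unfold rayQ'; fun_prop

lemma continuous_fluxT' {F : ℝ × E3 → ℝ} (hF : ContDiff ℝ ∞ F)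
    (b : OrthonormalBasis (Fin 3) ℝ E3) (t : ℝ) (x : E3) :
    Continuous (fun q : ℝ × ℝ × ℝ => fluxT' F b t x q.1 q.2.1 q.2.2) := by
  have h1 := continuous_fderiv_of_smooth hF
  have h2 := continuous_fderiv_fderiv hF
  have h3 := continuous_rayP b t x
  have h4 : Continuous (fun q : ℝ × ℝ × ℝ => sph b q.2.1 q.2.2) := by unfold sph; fun_prop
  have h5 : Continuous (fun q : ℝ × ℝ × ℝ => sphT b q.2.1 q.2.2) := by unfold sphT; fun_prop
  unfold fluxT'; fun_prop

lemma continuous_fluxN' {F : ℝ × E3 → ℝ} (hF : ContDiff ℝ ∞ F)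
    (b : OrthonormalBasis (Fin 3) ℝ E3) (t : ℝ) (x : E3) :
    Continuous (fun q : ℝ × ℝ × ℝ => fluxN' F b t x q.1 q.2.1 q.2.2) := by
  have h1 := continuous_fderiv_of_smooth hF
  have h2 := continuous_fderiv_fderiv hF
  have h3 := continuous_rayP b t x
  have h4 : Continuous (fun q : ℝ × ℝ × ℝ => sph b q.2.1 q.2.2) := by unfold sph; fun_prop
  have h5 : Continuous (fun q : ℝ × ℝ × ℝ => sphT b q.2.1 q.2.2) := by unfold sphT; fun_prop
  have h6 : Continuous (fun q : ℝ × ℝ × ℝ => sphN b q.2.2) := (continuous_sphN b).comp (by fun_prop)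
  unfold fluxN'; fun_prop

lemma intervalIntegral_swap_of_continuous (g : ℝ → ℝ → ℝ)
    (hg : Continuous (fun q : ℝ × ℝ => g q.1 q.2)) (a b c d : ℝ) :
    ∫ x in a..b, ∫ y in c..d, g x y = ∫ y in c..d, ∫ x in a..b, g x y := by
  apply MeasureTheory.intervalIntegral_intervalIntegral_swap
  have hK : IsCompact (Set.uIcc a b ×ˢ Set.uIcc c d) := isCompact_uIcc.prod isCompact_uIcc
  exact (hg.continuousOn.integrableOn_compact hK).mono_set
    (Set.prod_mono Set.uIoc_subset_uIcc Set.uIoc_subset_uIcc)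

lemma continuous_integral_param {X : Type*} [TopologicalSpace X] {g : X → ℝ → ℝ}
    (hg : Continuous (Function.uncurry g)) (a b : ℝ) :
    Continuous (fun x => ∫ y in a..b, g x y) :=
  intervalIntegral.continuous_parametric_intervalIntegral_of_continuous' hg a b

/-- The gradient vanishes initially when both initial data vanish. -/
lemma fderiv_initial_eq_zero {F : ℝ × E3 → ℝ} (hF : ContDiff ℝ ∞ F) (h0 : ∀ x, F (0, x) = 0)
    (h1 : ∀ x, fderiv ℝ F (0, x) (1, 0) = 0) (y v : E3) : fderiv ℝ F (0, y) (1, v) = 0 := by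
  have hc : HasDerivAt (fun s : ℝ => ((0 : ℝ), y + s • v)) ((0 : ℝ), v) 0 := by
    refine (hasDerivAt_const _ _).prodMk ?_
    simpa using ((hasDerivAt_id (0 : ℝ)).smul_const v).const_add y
  have h2 := hasDerivAt_comp_curve hF hc
  simp only [h0, zero_smul, add_zero] at h2
  have h3 := h2.unique (hasDerivAt_const 0 0)
  have e : ((1 : ℝ), v) = (1, 0) + (0, v) := by ext1 <;> simp
  rw [e, map_add, h1, h3, add_zero]

/-- Kirchhoff's formula for the wave equation with zero initial data. -/
theorem kirchhoff {F : ℝ × E3 → ℝ} (hF : ContDiff ℝ ∞ F) (h0 : ∀ x, F (0, x) = 0)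
    (h1 : ∀ x, fderiv ℝ F (0, x) (1, 0) = 0)
    (b : OrthonormalBasis (Fin 3) ℝ E3) (t : ℝ) (x : E3) :
    4 * π * F (t, x) = ∫ ρ in (0 : ℝ)..t, ∫ θ in (0 : ℝ)..π, ∫ φ in (0 : ℝ)..(2 * π),
      sin θ * (ρ * box F (rayP b t x ρ θ φ)) := by
  have hgrad := fderiv_initial_eq_zero hF h0 h1
  set A : ℝ → ℝ → ℝ → ℝ := fun ρ θ φ => sin θ * rayQ' F t x (sph b θ φ) ρ with hA
  have cA : Continuous (fun q : ℝ × ℝ × ℝ => A q.1 q.2.1 q.2.2) := by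
    have h4 : Continuous (fun q : ℝ × ℝ × ℝ => (q.1, sph b q.2.1 q.2.2)) := by
      unfold sph; fun_prop
    exact (continuous_sin.comp (by fun_prop)).mul ((continuous_rayQ' hF t x).comp h4)
  have cT := continuous_fluxT' hF b t x
  have cN := continuous_fluxN' hF b t x
  have iA : ∀ ρ θ, IntervalIntegrable (A ρ θ) volume 0 (2 * π) := fun ρ θ =>
    (cA.comp (f := fun φ => (ρ, θ, φ)) (by fun_prop)).intervalIntegrable _ _
  have iT : ∀ ρ θ, IntervalIntegrable (fluxT' F b t x ρ θ) volume 0 (2 * π) := fun ρ θ =>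
    (cT.comp (f := fun φ => (ρ, θ, φ)) (by fun_prop)).intervalIntegrable _ _
  have iN : ∀ ρ θ, IntervalIntegrable (fluxN' F b t x ρ θ) volume 0 (2 * π) := fun ρ θ =>
    (cN.comp (f := fun φ => (ρ, θ, φ)) (by fun_prop)).intervalIntegrable _ _
  have hN : ∀ ρ θ, ∫ φ in (0 : ℝ)..(2 * π), fluxN' F b t x ρ θ φ = 0 := by
    intro ρ θ
    rw [intervalIntegral.integral_eq_sub_of_hasDerivAt
      (fun φ _ => hasDerivAt_fluxN hF b t x ρ θ φ) (iN ρ θ)]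
    simp [fluxN, rayP, sph, sphN]
  have hφ : ∀ ρ θ, ∫ φ in (0 : ℝ)..(2 * π), sin θ * (ρ * box F (rayP b t x ρ θ φ)) =
      -(∫ φ in (0 : ℝ)..(2 * π), A ρ θ φ) - ∫ φ in (0 : ℝ)..(2 * π), fluxT' F b t x ρ θ φ := by
    intro ρ θ
    simp only [box_eq_divergence hF]
    have i1 : IntervalIntegrable (fun φ => -A ρ θ φ) volume 0 (2 * π) := (iA ρ θ).neg
    have i2 : IntervalIntegrable (fun φ => -A ρ θ φ - fluxT' F b t x ρ θ φ) volume 0 (2 * π) :=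
      i1.sub (iT ρ θ)
    change ∫ φ in (0 : ℝ)..(2 * π), (-A ρ θ φ - fluxT' F b t x ρ θ φ - fluxN' F b t x ρ θ φ) = _
    rw [intervalIntegral.integral_sub i2 (iN ρ θ), hN,
      intervalIntegral.integral_sub i1 (iT ρ θ), intervalIntegral.integral_neg, sub_zero]
  have hT : ∀ ρ, ∫ θ in (0 : ℝ)..π, ∫ φ in (0 : ℝ)..(2 * π), fluxT' F b t x ρ θ φ = 0 := by
    intro ρ
    rw [intervalIntegral_swap_of_continuous (fun θ φ => fluxT' F b t x ρ θ φ)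
      (cT.comp (f := fun q : ℝ × ℝ => (ρ, q.1, q.2)) (by fun_prop))]
    have : ∀ φ, ∫ θ in (0 : ℝ)..π, fluxT' F b t x ρ θ φ = 0 := by
      intro φ
      rw [intervalIntegral.integral_eq_sub_of_hasDerivAt
        (fun θ _ => hasDerivAt_fluxT hF b t x ρ θ φ)
        ((cT.comp (f := fun θ => (ρ, θ, φ)) (by fun_prop)).intervalIntegrable _ _)]
      simp [fluxT]
    simp [this]
  have cA2 : Continuous (fun q : ℝ × ℝ => ∫ φ in (0 : ℝ)..(2 * π), A q.1 q.2 φ) :=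
    continuous_integral_param (g := fun (q : ℝ × ℝ) φ => A q.1 q.2 φ)
      (cA.comp (f := fun z : (ℝ × ℝ) × ℝ => (z.1.1, z.1.2, z.2)) (by fun_prop)) _ _
  have cT2 : Continuous (fun q : ℝ × ℝ => ∫ φ in (0 : ℝ)..(2 * π), fluxT' F b t x q.1 q.2 φ) :=
    continuous_integral_param (g := fun (q : ℝ × ℝ) φ => fluxT' F b t x q.1 q.2 φ)
      (cT.comp (f := fun z : (ℝ × ℝ) × ℝ => (z.1.1, z.1.2, z.2)) (by fun_prop)) _ _
  have hθ : ∀ ρ, ∫ θ in (0 : ℝ)..π, ∫ φ in (0 : ℝ)..(2 * π),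
      sin θ * (ρ * box F (rayP b t x ρ θ φ)) =
      -∫ θ in (0 : ℝ)..π, ∫ φ in (0 : ℝ)..(2 * π), A ρ θ φ := by
    intro ρ
    simp only [hφ]
    rw [intervalIntegral.integral_sub, hT, intervalIntegral.integral_neg, sub_zero]
    · exact ((cA2.comp (f := fun θ => (ρ, θ)) (by fun_prop)).neg).intervalIntegrable _ _
    · exact ((cT2.comp (f := fun θ => (ρ, θ)) (by fun_prop))).intervalIntegrable _ _
  have hρ : ∀ θ φ, ∫ ρ in (0 : ℝ)..t, A ρ θ φ = -(sin θ * F (t, x)) := by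
    intro θ φ
    rw [intervalIntegral.integral_eq_sub_of_hasDerivAt
      (fun ρ _ => (hasDerivAt_rayQ hF t x (sph b θ φ) ρ).const_mul (sin θ))
      ((cA.comp (f := fun ρ => (ρ, θ, φ)) (by fun_prop)).intervalIntegrable _ _)]
    simp [rayQ, h0, hgrad]
  simp only [hθ]
  rw [intervalIntegral.integral_neg, intervalIntegral_swap_of_continuous
    (fun ρ θ => ∫ φ in (0 : ℝ)..(2 * π), A ρ θ φ) cA2]
  have : ∀ θ, ∫ ρ in (0 : ℝ)..t, ∫ φ in (0 : ℝ)..(2 * π), A ρ θ φ =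
      -(2 * π * (sin θ * F (t, x))) := by
    intro θ
    rw [intervalIntegral_swap_of_continuous (fun ρ φ => A ρ θ φ)
      (cA.comp (f := fun q : ℝ × ℝ => (q.1, θ, q.2)) (by fun_prop))]
    simp [hρ]
    ring
  simp only [this, intervalIntegral.integral_neg, intervalIntegral.integral_const_mul,
    intervalIntegral.integral_mul_const, integral_sin]
  simp
  ring

lemma norm_sq_basis (b : OrthonormalBasis (Fin 3) ℝ E3) (a c d : ℝ) :
    ‖a • b 0 + (c • b 1 + d • b 2)‖ ^ 2 = a ^ 2 + c ^ 2 + d ^ 2 := by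
  rw [← real_inner_self_eq_norm_sq]
  simp only [inner_add_left, inner_add_right, inner_smul_left, inner_smul_right,
    OrthonormalBasis.inner_eq_ite]
  simp
  ring

lemma norm_sph (b : OrthonormalBasis (Fin 3) ℝ E3) (θ φ : ℝ) : ‖sph b θ φ‖ = 1 := by
  have h : ‖sph b θ φ‖ ^ 2 = 1 := by
    have e : sph b θ φ = cos θ • b 0 + ((sin θ * cos φ) • b 1 + (sin θ * sin φ) • b 2) := by
      simp only [sph]; module
    rw [e, norm_sq_basis]
    have h1 := cos_sq' θ
    have h2 := cos_sq' φ
    simp only [mul_pow, h1, h2]; ring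
  exact (sq_eq_sq₀ (norm_nonneg _) zero_le_one).1 (by simpa using h)

lemma norm_add_smul_sph (b : OrthonormalBasis (Fin 3) ℝ E3) (r ρ θ φ : ℝ) :
    ‖r • b 0 + ρ • sph b θ φ‖ = √(r ^ 2 + ρ ^ 2 + 2 * r * ρ * cos θ) := by
  have e : r • b 0 + ρ • sph b θ φ = (r + ρ * cos θ) • b 0 +
      ((ρ * sin θ * cos φ) • b 1 + (ρ * sin θ * sin φ) • b 2) := by
    simp only [sph]; module
  rw [eq_comm, Real.sqrt_eq_iff_eq_sq, e, norm_sq_basis]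
  · have h1 := cos_sq' θ
    have h2 := cos_sq' φ
    ring_nf
    simp only [h1, h2]; ring
  · nlinarith [cos_le_one θ, neg_one_le_cos θ, sin_sq_add_cos_sq θ, sq_nonneg (r + ρ * cos θ),
      mul_nonneg (sq_nonneg ρ) (sq_nonneg (sin θ))]
  · positivity

/-- The integral of a function of the distance to the origin over a sphere. -/
lemma integral_radial {g : ℝ → ℝ} (hg : Continuous g) {r ρ s : ℝ} (hr : 0 < r) (hρ : 0 < ρ)
    (hne : ρ ≠ r) :
    ∫ θ in (0 : ℝ)..π, sin θ * ρ * ((√(r ^ 2 + ρ ^ 2 + 2 * r * ρ * cos θ))⁻¹ *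
      g (s + √(r ^ 2 + ρ ^ 2 + 2 * r * ρ * cos θ))) =
      r⁻¹ * ∫ p in (s + |r - ρ|)..(s + (r + ρ)), g p := by
  have hpos : ∀ θ, 0 < r ^ 2 + ρ ^ 2 + 2 * r * ρ * cos θ := by
    intro θ
    have h1 : 0 < (r - ρ) ^ 2 := by
      have : r - ρ ≠ 0 := sub_ne_zero.2 hne.symm
      positivity
    have h2 : 0 ≤ r * ρ * (1 + cos θ) :=
      mul_nonneg (by positivity) (by linarith [neg_one_le_cos θ])
    nlinarith
  have hd : ∀ θ, HasDerivAt (fun θ => s + √(r ^ 2 + ρ ^ 2 + 2 * r * ρ * cos θ))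
      ((2 * r * ρ * (-sin θ)) / (2 * √(r ^ 2 + ρ ^ 2 + 2 * r * ρ * cos θ))) θ := by
    intro θ
    exact ((((hasDerivAt_cos θ).const_mul (2 * r * ρ)).const_add _).sqrt (hpos θ).ne').const_add s
  have hcv := intervalIntegral.integral_comp_mul_deriv (a := 0) (b := π)
    (fun θ _ => hd θ) (g := g) (by
      refine Continuous.continuousOn (Continuous.div (by fun_prop) (by fun_prop) ?_)
      intro θ
      have := Real.sqrt_pos.2 (hpos θ)
      positivity) hg
  have e0 : √(r ^ 2 + ρ ^ 2 + 2 * r * ρ * cos 0) = r + ρ := by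
    rw [show r ^ 2 + ρ ^ 2 + 2 * r * ρ * cos 0 = (r + ρ) ^ 2 by simp; ring]
    exact Real.sqrt_sq (by positivity)
  have eπ : √(r ^ 2 + ρ ^ 2 + 2 * r * ρ * cos π) = |r - ρ| := by
    rw [show r ^ 2 + ρ ^ 2 + 2 * r * ρ * cos π = (r - ρ) ^ 2 by simp; ring]
    exact Real.sqrt_sq_eq_abs _
  simp only [e0, eπ] at hcv
  rw [intervalIntegral.integral_symm (s + (r + ρ)) (s + |r - ρ|), ← hcv, ← intervalIntegral.integral_neg,
    ← intervalIntegral.integral_const_mul]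
  refine intervalIntegral.integral_congr fun θ _ => ?_
  have := Real.sqrt_pos.2 (hpos θ)
  simp only [Function.comp]
  field_simp

lemma exists_basis_of_ne_zero {y : E3} (hy : y ≠ 0) :
    ∃ b : OrthonormalBasis (Fin 3) ℝ E3, y = ‖y‖ • b 0 := by
  have hn : ‖y‖ ≠ 0 := norm_ne_zero_iff.2 hy
  let v : Fin 3 → E3 := fun _ => ‖y‖⁻¹ • y
  have hv : Orthonormal ℝ (({0} : Set (Fin 3)).domRestrict v) := by
    constructor
    · intro i; change ‖‖y‖⁻¹ • y‖ = 1; simp [norm_smul, hn]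
    · intro i j hij; exact absurd (Subsingleton.elim i j) hij
  obtain ⟨b, hb⟩ := hv.exists_orthonormalBasis_extension_of_card_eq (by simp)
  refine ⟨b, ?_⟩
  rw [hb 0 rfl]
  simp [v, smul_smul, hn]

/-- Pointwise bound for solutions of the wave equation with zero initial data, in terms of a
radial majorant of the source on the backward cone. -/
theorem abs_le_of_radial_majorant {F : ℝ × E3 → ℝ} (hF : ContDiff ℝ ∞ F)
    (h0 : ∀ x, F (0, x) = 0) (h1 : ∀ x, fderiv ℝ F (0, x) (1, 0) = 0)
    {f : ℝ → ℝ → ℝ} (hf : Continuous (fun q : ℝ × ℝ => f q.1 q.2)) (hf0 : ∀ s p, 0 ≤ f s p)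
    {t : ℝ} (ht : 0 ≤ t) {y : E3} (hy : y ≠ 0)
    (hM : ∀ s z, 0 < s → ‖z - y‖ ≤ t - s → ‖z‖ * |box F (s, z)| ≤ f s (s + ‖z‖)) :
    |F (t, y)| ≤ 1 / (2 * ‖y‖) * ∫ s in (0 : ℝ)..t, ∫ p in |t - ‖y‖|..(t + ‖y‖), f s p := by
  obtain ⟨b, hb⟩ := exists_basis_of_ne_zero hy
  set r := ‖y‖ with hr
  have hrpos : 0 < r := norm_pos_iff.2 hy
  have hK := kirchhoff hF h0 h1 b t y
  set S : ℝ → ℝ := fun ρ => ∫ θ in (0 : ℝ)..π, ∫ φ in (0 : ℝ)..(2 * π),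
      sin θ * (ρ * box F (rayP b t y ρ θ φ)) 
  set R : ℝ → ℝ := fun s => ∫ p in |t - r|..(t + r), f s p 
  have cR : Continuous R := continuous_integral_param (g := f) hf _ _
  have key : ∀ ρ, 0 < ρ → ρ < t → ρ ≠ r → ‖S ρ‖ ≤ 2 * π / r * R (t - ρ) := by
    intro ρ hρ hρt hne
    set lam : ℝ → ℝ := fun θ => √(r ^ 2 + ρ ^ 2 + 2 * r * ρ * cos θ) with hlam
    have hn : ∀ θ φ, ‖y + ρ • sph b θ φ‖ = lam θ := by
      intro θ φ
      conv_lhs => rw [hb]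
      exact norm_add_smul_sph b r ρ θ φ
    have hlpos : ∀ θ, 0 < lam θ := by
      intro θ
      apply Real.sqrt_pos.2
      have h1 : 0 < (r - ρ) ^ 2 := by
        have : r - ρ ≠ 0 := sub_ne_zero.2 hne.symm
        positivity
      have h2 : 0 ≤ r * ρ * (1 + cos θ) :=
        mul_nonneg (by positivity) (by linarith [neg_one_le_cos θ])
      nlinarith
    have hbox : ∀ θ φ, |box F (rayP b t y ρ θ φ)| ≤
        (lam θ)⁻¹ * f (t - ρ) (t - ρ + lam θ) := by
      intro θ φ
      have := hM (t - ρ) (y + ρ • sph b θ φ) (by linarith)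
        (by simp [norm_smul, norm_sph, abs_of_pos hρ])
      rw [hn] at this
      rw [inv_mul_eq_div, le_div_iff₀ (hlpos θ), mul_comm]
      exact this
    have hφ : ∀ θ ∈ Set.Ioc 0 π, ‖∫ φ in (0 : ℝ)..(2 * π),
        sin θ * (ρ * box F (rayP b t y ρ θ φ))‖ ≤
        2 * π * (sin θ * ρ * ((lam θ)⁻¹ * f (t - ρ) (t - ρ + lam θ))) := by
      intro θ hθ
      have hs : 0 ≤ sin θ := sin_nonneg_of_nonneg_of_le_pi hθ.1.le hθ.2
      have := intervalIntegral.norm_integral_le_of_norm_le_const (a := 0) (b := 2 * π)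
        (f := fun φ => sin θ * (ρ * box F (rayP b t y ρ θ φ)))
        (C := sin θ * ρ * ((lam θ)⁻¹ * f (t - ρ) (t - ρ + lam θ))) (by
          intro φ _
          rw [Real.norm_eq_abs, abs_mul, abs_mul, abs_of_nonneg hs, abs_of_pos hρ, mul_assoc]
          gcongr
          exact hbox θ φ)
      rw [sub_zero, abs_of_pos two_pi_pos] at this
      linarith
    have hlc : Continuous lam := by simp only [hlam]; fun_prop
    have hgc : Continuous (fun p => f (t - ρ) p) :=
      hf.comp (f := fun p => (t - ρ, p)) (by fun_prop)
    have hθ : ‖S ρ‖ ≤ ∫ θ in (0 : ℝ)..π,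
        2 * π * (sin θ * ρ * ((lam θ)⁻¹ * f (t - ρ) (t - ρ + lam θ))) := by
      apply intervalIntegral.norm_integral_le_of_norm_le pi_pos.le
      · exact Filter.Eventually.of_forall hφ
      · apply Continuous.intervalIntegrable
        have h2 := hlc.inv₀ (fun θ => (hlpos θ).ne')
        have h3 : Continuous (fun θ => f (t - ρ) (t - ρ + lam θ)) :=
          hgc.comp (f := fun θ => t - ρ + lam θ) (by fun_prop)
        exact continuous_const.mul
          ((continuous_sin.mul continuous_const).mul (h2.mul h3))
    rw [intervalIntegral.integral_const_mul, integral_radial hgc hrpos hρ hne] at hθ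
    have e : t - ρ + (r + ρ) = t + r := by ring
    have hle : ∫ p in (t - ρ + |r - ρ|)..(t - ρ + (r + ρ)), f (t - ρ) p ≤ R (t - ρ) := by
      rw [e]
      apply intervalIntegral.integral_mono_interval
      · rcases abs_cases (t - r) with h | h <;> rcases abs_cases (r - ρ) with h' | h' <;> linarith
      · rcases abs_cases (r - ρ) with h' | h' <;> linarith
      · exact le_rfl
      · exact Filter.Eventually.of_forall fun p => hf0 _ _
      · exact hgc.intervalIntegrable _ _
    calc ‖S ρ‖ ≤ _ := hθ
      _ ≤ 2 * π * (r⁻¹ * R (t - ρ)) := by gcongr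
      _ = 2 * π / r * R (t - ρ) := by ring
  have hint : ‖∫ ρ in (0 : ℝ)..t, S ρ‖ ≤ ∫ ρ in (0 : ℝ)..t, 2 * π / r * R (t - ρ) := by
    apply intervalIntegral.norm_integral_le_of_norm_le ht
    · have hae : ∀ᵐ ρ : ℝ, ρ ≠ r ∧ ρ ≠ t := by
        have a1 : ∀ᵐ ρ : ℝ, ρ ≠ r := by simp [ae_iff, measure_singleton]
        have a2 : ∀ᵐ ρ : ℝ, ρ ≠ t := by simp [ae_iff, measure_singleton]
        filter_upwards [a1, a2] with ρ h h' using ⟨h, h'⟩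
      filter_upwards [hae] with ρ h hm
      exact key ρ hm.1 (lt_of_le_of_ne hm.2 h.2) h.1
    · exact (continuous_const.mul (cR.comp (by fun_prop))).intervalIntegrable _ _
  rw [← hK, intervalIntegral.integral_const_mul, intervalIntegral.integral_comp_sub_left
    (fun s => R s) t, sub_self, sub_zero, norm_mul, Real.norm_eq_abs,
    abs_of_pos (by positivity : 0 < 4 * π), Real.norm_eq_abs] at hint
  have hp := pi_pos
  have e : 2 * π / r * ∫ s in (0 : ℝ)..t, R s =
      4 * π * (1 / (2 * r) * ∫ s in (0 : ℝ)..t, R s) := by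
    field_simp; ring
  rw [e] at hint
  exact le_of_mul_le_mul_left hint (by positivity)

lemma one_le_jb (a : ℝ) : 1 ≤ jb a := by
  unfold jb
  rw [Real.one_le_sqrt]
  nlinarith [sq_nonneg a]

lemma jb_pos (a : ℝ) : 0 < jb a := one_pos.trans_le (one_le_jb a)

lemma jb_sq (a : ℝ) : jb a ^ 2 = 1 + a ^ 2 := Real.sq_sqrt (by positivity)

lemma continuous_jb : Continuous jb := by unfold jb; fun_prop

lemma jb_le_jb {a b : ℝ} (ha : 0 ≤ a) (hab : a ≤ b) : jb a ≤ jb b :=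
  Real.sqrt_le_sqrt (by gcongr)

lemma continuous_jb_rpow (ν : ℝ) : Continuous fun z => jb z ^ ν :=
  continuous_jb.rpow_const fun z => Or.inl (jb_pos z).ne'

lemma jb_rpow_nonneg (z ν : ℝ) : 0 ≤ jb z ^ ν := (Real.rpow_pos_of_pos (jb_pos z) ν).le

lemma integrable_jb_rpow {ν : ℝ} (hν : 1 < ν) : Integrable fun z => jb z ^ (-ν) := by
  have h := integrable_rpow_neg_one_add_norm_sq (E := ℝ) (μ := volume) (r := ν) (by simpa using hν)
  refine h.congr (Filter.Eventually.of_forall fun z => ?_)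
  simp only [jb, Real.sqrt_eq_rpow, norm_eq_abs, sq_abs]
  rw [← Real.rpow_mul (by positivity)]
  congr 1; ring

/-- The integral of the bracket weight over the real line. -/
def jbInt (ν : ℝ) : ℝ := ∫ z, jb z ^ (-ν)

lemma jbInt_nonneg (ν : ℝ) : 0 ≤ jbInt ν := integral_nonneg fun z => jb_rpow_nonneg z _

lemma integral_jb_affine_le {ν : ℝ} (hν : 1 < ν) {c : ℝ} (hc : 1 ≤ c) (d : ℝ) {a b : ℝ}
    (hab : a ≤ b) : ∫ s in a..b, jb (c * s - d) ^ (-ν) ≤ jbInt ν := by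
  rw [intervalIntegral.integral_comp_mul_sub (fun z => jb z ^ (-ν)) (by positivity : c ≠ 0) d,
    smul_eq_mul]
  have hle : c * a - d ≤ c * b - d := by gcongr
  have h1 : ∫ z in (c * a - d)..(c * b - d), jb z ^ (-ν) ≤ jbInt ν := by
    rw [intervalIntegral.integral_of_le hle]
    exact setIntegral_le_integral (integrable_jb_rpow hν)
      (Filter.Eventually.of_forall fun z => jb_rpow_nonneg z _)
  have h2 : 0 ≤ ∫ z in (c * a - d)..(c * b - d), jb z ^ (-ν) :=
    intervalIntegral.integral_nonneg hle fun z _ => jb_rpow_nonneg z _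
  exact (mul_le_of_le_one_left h2 (inv_le_one_of_one_le₀ hc)).trans h1

/-- A smooth substitute for the inverse of the weight. -/
def wsum {N : ℕ} (cs : Fin N → ℝ) (ν t r : ℝ) : ℝ :=
  ∑ j : Fin (N + 1), jb (cs0 cs j * t - r) ^ (-ν)

lemma wsum_nonneg {N : ℕ} (cs : Fin N → ℝ) (ν t r : ℝ) : 0 ≤ wsum cs ν t r :=
  Finset.sum_nonneg fun _ _ => jb_rpow_nonneg _ _

lemma continuous_wsum {N : ℕ} (cs : Fin N → ℝ) (ν : ℝ) :
    Continuous fun q : ℝ × ℝ => wsum cs ν q.1 q.2 :=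
  continuous_finsetSum _ fun j _ => (continuous_jb_rpow (-ν)).comp
    (by fun_prop : Continuous fun q : ℝ × ℝ => cs0 cs j * q.1 - q.2)

lemma exists_wgt_eq {N : ℕ} (cs : Fin N → ℝ) (t r : ℝ) :
    ∃ j, wgt cs t r = jb (cs0 cs j * t - r) := by
  obtain ⟨j, -, hj⟩ := Finset.exists_mem_eq_inf' (s := (Finset.univ : Finset (Fin (N + 1))))
    Finset.univ_nonempty fun j => jb (cs0 cs j * t - r)
  exact ⟨j, hj⟩

lemma wgt_pos {N : ℕ} (cs : Fin N → ℝ) (t r : ℝ) : 0 < wgt cs t r := by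
  obtain ⟨j, hj⟩ := exists_wgt_eq cs t r
  exact hj ▸ jb_pos _

lemma wgt_rpow_neg_le {N : ℕ} (cs : Fin N → ℝ) (ν t r : ℝ) :
    wgt cs t r ^ (-ν) ≤ wsum cs ν t r := by
  obtain ⟨j, hj⟩ := exists_wgt_eq cs t r
  rw [hj]
  exact Finset.single_le_sum (f := fun j => jb (cs0 cs j * t - r) ^ (-ν))
    (fun j _ => jb_rpow_nonneg _ _) (Finset.mem_univ j)

lemma continuous_wgt {N : ℕ} (cs : Fin N → ℝ) : Continuous fun q : ℝ × ℝ => wgt cs q.1 q.2 :=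
  Continuous.finset_inf'_apply _ fun j _ => continuous_jb.comp
    (by fun_prop : Continuous fun q : ℝ × ℝ => cs0 cs j * q.1 - q.2)

lemma cs0_nonneg {N : ℕ} {cs : Fin N → ℝ} (hcs : ∀ j, 0 < cs j) (j : Fin (N + 1)) :
    0 ≤ cs0 cs j := by
  refine Fin.cases ?_ (fun i => ?_) j
  · simp [cs0]
  · simpa [cs0] using (hcs i).le

lemma integral_wsum_incoming_le {N : ℕ} {cs : Fin N → ℝ} (hcs : ∀ j, 0 < cs j) {ν : ℝ}
    (hν : 1 < ν) (p : ℝ) {a b : ℝ} (hab : a ≤ b) :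
    ∫ s in a..b, wsum cs ν s (p - s) ≤ (N + 1) * jbInt ν := by
  have hc : ∀ j, Continuous fun s => jb (cs0 cs j * s - (p - s)) ^ (-ν) := fun j =>
    (continuous_jb_rpow (-ν)).comp (by fun_prop)
  unfold wsum
  rw [intervalIntegral.integral_finsetSum fun j _ => (hc j).intervalIntegrable _ _]
  calc _ ≤ ∑ _j : Fin (N + 1), jbInt ν := by
        refine Finset.sum_le_sum fun j _ => ?_
        have := integral_jb_affine_le hν (c := cs0 cs j + 1) (by linarith [cs0_nonneg hcs j]) p hab
        refine le_trans (le_of_eq ?_) this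
        congr 1; funext s; congr 2; ring
    _ = _ := by simp

lemma integral_inv_one_add_sq_le {T l : ℝ} (hl : 0 < l) (hT : l ≤ T) :
    ∫ p in |T - 2 * l|..T, (1 + p ^ 2)⁻¹ ≤ 32 * l ^ 2 / T ^ 2 * (l⁻¹ + (1 + |T - 2 * l|)⁻¹) := by
  have hT0 : 0 < T := hl.trans_le hT
  set q := |T - 2 * l| with hq
  have hq0 : 0 ≤ q := abs_nonneg _
  have hqT : q ≤ T := abs_le.2 ⟨by linarith, by linarith⟩
  have hcont : Continuous fun p : ℝ => (1 + p ^ 2)⁻¹ :=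
    Continuous.inv₀ (by fun_prop) fun p => by positivity
  rcases le_total l (T / 4) with h | h
  · have hqe : q = T - 2 * l := abs_of_nonneg (by linarith)
    have h1 : ∫ p in q..T, (1 + p ^ 2)⁻¹ ≤ ∫ p in q..T, 4 / T ^ 2 := by
      refine intervalIntegral.integral_mono_on hqT (hcont.intervalIntegrable _ _) (by simp) ?_
      intro p hp
      have hp1 : T / 2 ≤ p := by linarith [hp.1]
      rw [inv_le_comm₀ (by positivity) (by positivity), inv_div]
      nlinarith
    rw [intervalIntegral.integral_const, smul_eq_mul, show T - q = 2 * l by linarith] at h1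
    have h2 : 32 * l ^ 2 / T ^ 2 * l⁻¹ = 8 * (4 * l / T ^ 2) := by field_simp; norm_num
    have h3 : 0 ≤ 32 * l ^ 2 / T ^ 2 * (1 + q)⁻¹ := by positivity
    have h4 : 0 ≤ l / T ^ 2 := by positivity
    have h5 : 2 * l * (4 / T ^ 2) = 8 * (l / T ^ 2) := by ring
    have h6 : 4 * l / T ^ 2 = 4 * (l / T ^ 2) := by ring
    rw [mul_add]
    linarith
  · have h1 : ∫ p in q..T, (1 + p ^ 2)⁻¹ ≤ ∫ p in q..T, 2 / (1 + p) ^ 2 := by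
      refine intervalIntegral.integral_mono_on hqT (hcont.intervalIntegrable _ _) ?_ ?_
      · refine ContinuousOn.intervalIntegrable_of_Icc hqT ?_
        refine ContinuousOn.div (by fun_prop) (by fun_prop) fun p hp => ?_
        have := hq0.trans hp.1
        positivity
      · intro p hp
        have := hq0.trans hp.1
        rw [inv_le_comm₀ (by positivity) (by positivity), inv_div,
          div_le_iff₀ (by norm_num)]
        nlinarith [sq_nonneg (p - 1)]
    have h2 : ∫ p in q..T, 2 / (1 + p) ^ 2 = -2 / (1 + T) - -2 / (1 + q) := by
      refine intervalIntegral.integral_eq_sub_of_hasDerivAt (f := fun p => -2 / (1 + p)) ?_ ?_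
      · intro p hp
        rw [Set.uIcc_of_le hqT] at hp
        have := hq0.trans hp.1
        have h := ((hasDerivAt_id p).const_add 1).inv (by simp; positivity)
        refine ((h.const_mul (-2)).congr_deriv ?_).congr_of_eventuallyEq
          (Filter.Eventually.of_forall fun p => by simp [div_eq_mul_inv])
        simp; ring
      · refine ContinuousOn.intervalIntegrable_of_Icc hqT ?_
        refine ContinuousOn.div (by fun_prop) (by fun_prop) fun p hp => ?_
        have := hq0.trans hp.1
        positivity
    have h3 : 2 ≤ 32 * l ^ 2 / T ^ 2 := by
      rw [le_div_iff₀ (by positivity)]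
      nlinarith
    have h4 : (0 : ℝ) ≤ 2 / (1 + T) := by positivity
    calc _ ≤ 2 * (1 + q)⁻¹ := by
          rw [h2, neg_div, neg_div] at h1
          rw [← div_eq_mul_inv]; linarith
      _ ≤ 32 * l ^ 2 / T ^ 2 * (l⁻¹ + (1 + q)⁻¹) := by
          have : 0 ≤ l⁻¹ := by positivity
          gcongr
          linarith

lemma continuous_inv_one_add_abs : Continuous fun x : ℝ => (1 + |x|)⁻¹ :=
  Continuous.inv₀ (by fun_prop) fun x => by positivity

lemma integral_inv_one_add_abs {T : ℝ} (hT : 0 ≤ T) :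
    ∫ x in (0 : ℝ)..T, (1 + |x|)⁻¹ = log (1 + T) := by
  have : ∫ x in (0 : ℝ)..T, (1 + |x|)⁻¹ = log (1 + T) - log (1 + 0) := by
    refine intervalIntegral.integral_eq_sub_of_hasDerivAt (f := fun p => log (1 + p)) ?_
      (continuous_inv_one_add_abs.intervalIntegrable _ _)
    intro p hp
    rw [Set.uIcc_of_le hT] at hp
    have h0 := hp.1
    have := ((hasDerivAt_id p).const_add 1).log (ne_of_gt (by simp only [id]; linarith))
    simpa [abs_of_nonneg h0] using this
  simpa using this

lemma integral_log_kernel_le {r T : ℝ} (hr : 1 ≤ r) (hrT : r ≤ T) :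
    ∫ ρ in r..T, (ρ⁻¹ + (1 + |T - 2 * ρ|)⁻¹) ≤ 2 * log (2 + T) := by
  have hc : Continuous fun ρ : ℝ => (1 + |T - 2 * ρ|)⁻¹ :=
    continuous_inv_one_add_abs.comp (by fun_prop : Continuous fun ρ : ℝ => T - 2 * ρ)
  have hi : IntervalIntegrable (fun ρ : ℝ => ρ⁻¹) volume r T :=
    intervalIntegral.intervalIntegrable_inv (fun x hx => by
      rw [Set.uIcc_of_le hrT] at hx; linarith [hx.1]) continuousOn_id
  rw [intervalIntegral.integral_add hi (hc.intervalIntegrable _ _),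
    integral_inv_of_pos (by linarith) (by linarith)]
  have h1 : log (T / r) ≤ log (2 + T) := by
    apply Real.log_le_log (div_pos (by linarith) (by linarith))
    rw [div_le_iff₀ (by linarith)]; nlinarith
  have h2 : ∫ ρ in r..T, (1 + |T - 2 * ρ|)⁻¹ ≤ log (2 + T) := by
    calc _ ≤ ∫ ρ in (0 : ℝ)..T, (1 + |T - 2 * ρ|)⁻¹ :=
          intervalIntegral.integral_mono_interval (by linarith) hrT le_rfl
            (Filter.Eventually.of_forall fun ρ => by positivity) (hc.intervalIntegrable _ _)
      _ = log (1 + T) := by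
          have := intervalIntegral.integral_comp_sub_mul (a := 0) (b := T)
            (fun x : ℝ => (1 + |x|)⁻¹) (two_ne_zero) T
          rw [this, mul_zero, sub_zero, show T - 2 * T = -T by ring,
            ← intervalIntegral.integral_add_adjacent_intervals (b := 0)
              (continuous_inv_one_add_abs.intervalIntegrable _ _)
              (continuous_inv_one_add_abs.intervalIntegrable _ _),
            integral_inv_one_add_abs (by linarith)]
          have h := intervalIntegral.integral_comp_neg (a := 0) (b := T)
            (fun x : ℝ => (1 + |x|)⁻¹)
          simp only [abs_neg, neg_zero] at h
          rw [← h, integral_inv_one_add_abs (by linarith), smul_eq_mul]; ring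
      _ ≤ log (2 + T) := Real.log_le_log (by linarith) (by linarith)
  linarith

lemma continuous_incoming_majorant {N : ℕ} (cs : Fin N → ℝ) (ν M : ℝ) :
    Continuous fun q : ℝ × ℝ => M * (1 + q.2 ^ 2)⁻¹ * wsum cs ν q.1 (q.2 - q.1) := by
  have hinv : Continuous fun p : ℝ => (1 + p ^ 2)⁻¹ :=
    Continuous.inv₀ (by fun_prop) fun p => by positivity
  have h : Continuous fun q : ℝ × ℝ => wsum cs ν q.1 (q.2 - q.1) :=
    (continuous_wsum cs ν).comp (f := fun q : ℝ × ℝ => (q.1, q.2 - q.1)) (by fun_prop)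
  exact (continuous_const.mul (hinv.comp continuous_snd)).mul h

lemma integral_incoming_majorant_le {N : ℕ} {cs : Fin N → ℝ} (hcs : ∀ j, 0 < cs j) {ν : ℝ}
    (hν : 1 < ν) {M : ℝ} (hM0 : 0 ≤ M) {t : ℝ} (ht : 0 ≤ t) {a b : ℝ} (hab : a ≤ b) :
    ∫ s in (0 : ℝ)..t, ∫ p in a..b, M * (1 + p ^ 2)⁻¹ * wsum cs ν s (p - s) ≤
      M * ((N + 1) * jbInt ν) * ∫ p in a..b, (1 + p ^ 2)⁻¹ := by
  have hinv : Continuous fun p : ℝ => (1 + p ^ 2)⁻¹ :=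
    Continuous.inv₀ (by fun_prop) fun p => by positivity
  have hfc := continuous_incoming_majorant cs ν M
  rw [intervalIntegral_swap_of_continuous
    (fun s p => M * (1 + p ^ 2)⁻¹ * wsum cs ν s (p - s)) hfc,
    ← intervalIntegral.integral_const_mul]
  have hi : Continuous fun p : ℝ => ∫ s in (0 : ℝ)..t, M * (1 + p ^ 2)⁻¹ * wsum cs ν s (p - s) :=
    continuous_integral_param (X := ℝ)
      (g := fun p s => M * (1 + p ^ 2)⁻¹ * wsum cs ν s (p - s))
      (hfc.comp continuous_swap) 0 t
  refine intervalIntegral.integral_mono_on hab (hi.intervalIntegrable _ _)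
    ((continuous_const.mul hinv).intervalIntegrable _ _) fun p _ => ?_
  rw [intervalIntegral.integral_const_mul, mul_right_comm M (_ * _)]
  exact mul_le_mul_of_nonneg_left (integral_wsum_incoming_le hcs hν p ht)
    (by positivity : 0 ≤ M * (1 + p ^ 2)⁻¹)

/-- Pointwise decay of a wave with zero data whose source is controlled by the weights. -/
theorem abs_le_of_weighted_source {N : ℕ} {cs : Fin N → ℝ} (hcs : ∀ j, 0 < cs j) {ν : ℝ}
    (hν : 1 < ν) {F : ℝ × E3 → ℝ} (hF : ContDiff ℝ ∞ F) (h0 : ∀ x, F (0, x) = 0)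
    (h1 : ∀ x, fderiv ℝ F (0, x) (1, 0) = 0) {t : ℝ} (ht : 0 ≤ t) {y : E3} (hy : y ≠ 0) {M : ℝ}
    (hM0 : 0 ≤ M)
    (hM : ∀ s z, 0 < s → ‖z - y‖ ≤ t - s →
      ‖z‖ * |box F (s, z)| ≤ M * (1 + (s + ‖z‖) ^ 2)⁻¹ * wsum cs ν s ‖z‖) :
    |F (t, y)| ≤ M * ((N + 1) * jbInt ν) * (16 * ‖y‖ / (t + ‖y‖) ^ 2) *
      (‖y‖⁻¹ + (1 + |t + ‖y‖ - 2 * ‖y‖|)⁻¹) := by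
  have hyp : 0 < ‖y‖ := norm_pos_iff.2 hy
  have hle : |t - ‖y‖| ≤ t + ‖y‖ := abs_le.2 ⟨by linarith, by linarith⟩
  refine (abs_le_of_radial_majorant hF h0 h1
    (f := fun s p => M * (1 + p ^ 2)⁻¹ * wsum cs ν s (p - s)) (continuous_incoming_majorant cs ν M)
    (fun s p => mul_nonneg (by positivity) (wsum_nonneg _ _ _ _)) ht hy
    (fun s z hs hz => by simpa only [add_sub_cancel_left] using hM s z hs hz)).trans ?_
  have h2 := integral_incoming_majorant_le hcs hν hM0 ht hle
  have h3 := integral_inv_one_add_sq_le hyp (by linarith : ‖y‖ ≤ t + ‖y‖)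
  rw [show t + ‖y‖ - 2 * ‖y‖ = t - ‖y‖ by ring] at h3 ⊢
  have hB : 0 ≤ M * ((N + 1) * jbInt ν) := by
    have := jbInt_nonneg ν; positivity
  calc _ ≤ 1 / (2 * ‖y‖) * (M * ((N + 1) * jbInt ν) *
        (32 * ‖y‖ ^ 2 / (t + ‖y‖) ^ 2 * (‖y‖⁻¹ + (1 + |t - ‖y‖|)⁻¹))) := by
        gcongr
        exact h2.trans (mul_le_mul_of_nonneg_left h3 hB)
    _ = _ := by field_simp; ring

/-- The spherical Laplacian, written through the rotation fields. -/
def rotSq (F : ℝ × E3 → ℝ) : ℝ × E3 → ℝ := fun p =>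
  rot 0 1 (rot 0 1 F) p + rot 0 2 (rot 0 2 F) p + rot 1 2 (rot 1 2 F) p

lemma prod_zero_eq_sum_sv (w : E3) : ((0 : ℝ), w) = w 0 • sv 0 + w 1 • sv 1 + w 2 • sv 2 := by
  refine Prod.ext ?_ ?_
  · simp [sv]
  · ext i
    fin_cases i <;> simp [sv]

lemma rotSq_eq {F : ℝ × E3 → ℝ} (hF : ContDiff ℝ ∞ F) (σ ρ : ℝ) {w : E3} (hw : ‖w‖ = 1) :
    rotSq F (σ, ρ • w) = ρ ^ 2 * (∑ j, fderiv ℝ (fderiv ℝ F) (σ, ρ • w) (sv j) (sv j)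
      - fderiv ℝ (fderiv ℝ F) (σ, ρ • w) (0, w) (0, w))
      - 2 * ρ * fderiv ℝ F (σ, ρ • w) (0, w) := by
  have hw2 : w 0 ^ 2 + w 1 ^ 2 + w 2 ^ 2 = 1 := by
    have := EuclideanSpace.norm_sq_eq w
    rw [hw, Fin.sum_univ_three] at this
    simpa using this.symm
  set p : ℝ × E3 := (σ, ρ • w) with hp
  have hpc : ∀ j, p.2 j = ρ * w j := fun j => by simp [hp]
  have h10 := fderiv_fderiv_comm hF (sv 1) (sv 0) p
  have h20 := fderiv_fderiv_comm hF (sv 2) (sv 0) p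
  have h21 := fderiv_fderiv_comm hF (sv 2) (sv 1) p
  have e : ∀ j k, rot j k (rot j k F) p = p.2 j * (rot j k (dd (sv k) F) p
      + ((sv k).2 j * dd (sv k) F p - (sv k).2 k * dd (sv j) F p))
      - p.2 k * (rot j k (dd (sv j) F) p
      + ((sv j).2 j * dd (sv k) F p - (sv j).2 k * dd (sv j) F p)) := by
    intro j k
    change p.2 j * dd (sv k) (rot j k F) p - p.2 k * dd (sv j) (rot j k F) p = _
    rw [dd_rot hF, dd_rot hF]
  have hsv : ∀ i j, (sv j).2 i = if i = j then 1 else 0 := fun i j => by simp [sv]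
  rw [prod_zero_eq_sum_sv w]
  unfold rotSq
  rw [e, e, e]
  simp only [rot, fderiv_dd hF, hpc, Fin.sum_univ_three, map_add, map_smul,
    add_apply, smul_apply, smul_eq_mul, h10, h20, h21]
  simp only [hsv, dd]
  simp
  linear_combination ρ ^ 2 * (fderiv ℝ (fderiv ℝ F) p (sv 0) (sv 0)
    + fderiv ℝ (fderiv ℝ F) p (sv 1) (sv 1) + fderiv ℝ (fderiv ℝ F) p (sv 2) (sv 2)) * hw2

lemma rayQ'_eq {F : ℝ × E3 → ℝ} (hF : ContDiff ℝ ∞ F) (T : ℝ) {ρ : ℝ} (hρ : ρ ≠ 0) {w : E3}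
    (hw : ‖w‖ = 1) : rayQ' F T 0 w ρ =
      -(ρ * box F (T - ρ, ρ • w) + ρ⁻¹ * rotSq F (T - ρ, ρ • w)) := by
  rw [rotSq_eq hF _ _ hw]
  unfold rayQ' box
  simp only [zero_add, fderiv_dd hF, tv]
  field_simp
  ring

lemma rayQ_eq_integral {F : ℝ × E3 → ℝ} (hF : ContDiff ℝ ∞ F) (h0 : ∀ x, F (0, x) = 0)
    (h1 : ∀ x, fderiv ℝ F (0, x) (1, 0) = 0) (T r : ℝ) (w : E3) :
    rayQ F T 0 w r = -∫ ρ in r..T, rayQ' F T 0 w ρ := by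
  have hc : Continuous fun ρ => rayQ' F T 0 w ρ :=
    (continuous_rayQ' hF T 0).comp (f := fun ρ => (ρ, w)) (by fun_prop)
  rw [intervalIntegral.integral_eq_sub_of_hasDerivAt (fun ρ _ => hasDerivAt_rayQ hF T 0 w ρ)
    (hc.intervalIntegrable _ _)]
  simp [rayQ, h0, fderiv_initial_eq_zero hF h0 h1]

lemma deriv_Vrad_add_deriv_Vrad {u : Fn} (hu : Smooth u) (w : E3) (t r : ℝ) :
    deriv (fun s => Vrad u w s r) t + deriv (fun ρ => Vrad u w t ρ) r =
      rayQ (un u) (t + r) 0 w r := by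
  have hF : ContDiff ℝ ∞ (un u) := hu
  have h1 : HasDerivAt (fun s : ℝ => (s, r • w)) ((1 : ℝ), (0 : E3)) t :=
    (hasDerivAt_id t).prodMk (hasDerivAt_const _ _)
  have h2 : HasDerivAt (fun ρ : ℝ => (t, ρ • w)) ((0 : ℝ), w) r := by
    refine (hasDerivAt_const _ _).prodMk ?_
    simpa using (hasDerivAt_id r).smul_const w
  have d1 := ((hasDerivAt_comp_curve hF h1).const_mul r).deriv
  have d2 := ((hasDerivAt_id r).mul (hasDerivAt_comp_curve hF h2)).deriv
  have e1 : (fun s => Vrad u w s r) = fun s => r * un u (s, r • w) := rfl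
  have e2 : (fun ρ => Vrad u w t ρ) = id * fun ρ => un u (t, ρ • w) := rfl
  have e3 : ((1 : ℝ), w) = (1, 0) + (0, w) := by ext1 <;> simp
  rw [e1, e2, d1, d2, rayQ, e3, map_add]
  simp only [add_sub_cancel_right, zero_add, id]
  ring

lemma rot_eqOn {F G : ℝ × E3 → ℝ} {U : Set (ℝ × E3)} (hU : IsOpen U) (h : Set.EqOn F G U)
    (j k : Fin 3) : Set.EqOn (rot j k F) (rot j k G) U := by
  intro p hp
  have := (h.eventuallyEq_of_mem (hU.mem_nhds hp)).fderiv_eq (𝕜 := ℝ)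
  simp only [rot, dd, this]

lemma box_un_eq {G u : Fn} (h : IsWaveSol 1 G u) {t : ℝ} (ht : 0 < t) (x : E3) :
    box (un u) (t, x) = G t x := by
  obtain ⟨hu, he, -⟩ := h
  rw [← he t x ht]
  unfold box
  simp only [← un_pt hu, ← un_pt (smooth_pt hu), ← un_pd hu, ← un_pd (smooth_pd hu _)]
  simp [un]

lemma box_rot_rot_un_eq {G u : Fn} (hG : Smooth G) (h : IsWaveSol 1 G u) (j k : Fin 3) {t : ℝ}
    (ht : 0 < t) (x : E3) :
    box (rot j k (rot j k (un u))) (t, x) = rotA j k (rotA j k G) t x := by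
  have hF : ContDiff ℝ ∞ (un u) := h.1
  rw [box_rot (contDiff_rot hF j k), box_rot hF]
  have hU : IsOpen {p : ℝ × E3 | 0 < p.1} := isOpen_lt continuous_const continuous_fst
  have e : Set.EqOn (box (un u)) (un G) {p : ℝ × E3 | 0 < p.1} := fun p hp =>
    box_un_eq h hp p.2
  have := rot_eqOn hU (rot_eqOn hU e j k) j k (show (t, x) ∈ _ from ht)
  rw [this, ← un_rotA hG, ← un_rotA (smooth_rotA hG j k)]
  rfl

lemma rot_initial_eq_zero {F : ℝ × E3 → ℝ} (hF : ContDiff ℝ ∞ F) (h0 : ∀ x, F (0, x) = 0)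
    (j k : Fin 3) (x : E3) : rot j k F (0, x) = 0 := by
  have h : ∀ v : E3, fderiv ℝ F (0, x) (0, v) = 0 := by
    intro v
    have hc : HasDerivAt (fun s : ℝ => ((0 : ℝ), x + s • v)) ((0 : ℝ), v) 0 := by
      refine (hasDerivAt_const _ _).prodMk ?_
      simpa using ((hasDerivAt_id (0 : ℝ)).smul_const v).const_add x
    have h2 := hasDerivAt_comp_curve hF hc
    simp only [h0, zero_smul, add_zero] at h2
    exact h2.unique (hasDerivAt_const 0 0)
  simp [rot, dd, sv, h]

lemma rot_initial_deriv_eq_zero {F : ℝ × E3 → ℝ} (hF : ContDiff ℝ ∞ F)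
    (h1 : ∀ x, fderiv ℝ F (0, x) (1, 0) = 0) (j k : Fin 3) (x : E3) :
    fderiv ℝ (rot j k F) (0, x) (1, 0) = 0 := by
  change dd tv (rot j k F) (0, x) = 0
  rw [dd_rot hF]
  have := rot_initial_eq_zero (contDiff_dd hF tv) h1 j k x
  simp only [this]
  simp [tv]

lemma initial_data {G u : Fn} (h : IsWaveSol 1 G u) :
    (∀ x, un u (0, x) = 0) ∧ ∀ x, fderiv ℝ (un u) (0, x) (1, 0) = 0 := by
  refine ⟨h.2.2.1, fun x => ?_⟩
  have := congrFun (un_pt h.1) (0, x)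
  exact this.symm.trans (h.2.2.2 x)

lemma abs_Zpow_le_vnorm {s : ℕ} {α : Fin 7 → ℕ} (hα : α ∈ multiIdx s) (G : Fn) (t : ℝ) (x : E3) :
    |Zpow α G t x| ≤ vnorm s G t x :=
  Finset.single_le_sum (f := fun α => |Zpow α G t x|) (fun _ _ => abs_nonneg _) hα

lemma abs_le_vnorm_two (G : Fn) (t : ℝ) (x : E3) : |G t x| ≤ vnorm 2 G t x :=
  abs_Zpow_le_vnorm (α := 0) (by simp [multiIdx]) G t x

lemma abs_rotA_rotA_le_vnorm_two (G : Fn) (t : ℝ) (x : E3) :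
    |rotA 0 1 (rotA 0 1 G) t x| ≤ vnorm 2 G t x ∧ |rotA 0 2 (rotA 0 2 G) t x| ≤ vnorm 2 G t x ∧
      |rotA 1 2 (rotA 1 2 G) t x| ≤ vnorm 2 G t x :=
  ⟨abs_Zpow_le_vnorm (α := ![0, 0, 0, 0, 2, 0, 0])
      (by simp [multiIdx, Fin.forall_fin_succ, Fin.sum_univ_succ]) G t x,
    abs_Zpow_le_vnorm (α := ![0, 0, 0, 0, 0, 2, 0])
      (by simp [multiIdx, Fin.forall_fin_succ, Fin.sum_univ_succ]) G t x,
    abs_Zpow_le_vnorm (α := ![0, 0, 0, 0, 0, 0, 2])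
      (by simp [multiIdx, Fin.forall_fin_succ, Fin.sum_univ_succ]) G t x⟩

lemma continuous_vnorm {G : Fn} (hG : Smooth G) (s : ℕ) :
    Continuous fun p : ℝ × E3 => vnorm s G p.1 p.2 :=
  continuous_finsetSum _ fun α _ => (smooth_Zpow hG α).continuous.abs

lemma vnorm_nonneg (s : ℕ) (G : Fn) (t : ℝ) (x : E3) : 0 ≤ vnorm s G t x :=
  Finset.sum_nonneg fun _ _ => abs_nonneg _

lemma le_Afun {N : ℕ} (cs : Fin N → ℝ) (κ μ : ℝ) {s : ℕ} {G : Fn} (hG : Smooth G) {t τ : ℝ}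
    {x y : E3} (hτ : 0 ≤ τ) (hτt : τ ≤ t) (hy : ‖y - x‖ ≤ t - τ) :
    ‖y‖ * jb (τ + ‖y‖) ^ κ * wgt cs τ ‖y‖ ^ (1 + μ) * vnorm s G τ y ≤ Afun κ μ s G 1 cs t x := by
  refine le_csSup ?_ ⟨τ, y, hτ, hτt, by simpa using hy, rfl⟩
  have hK : IsCompact (Set.Icc (0 : ℝ) t ×ˢ Metric.closedBall x t) :=
    isCompact_Icc.prod (isCompact_closedBall x t)
  have hw : Continuous fun p : ℝ × E3 => wgt cs p.1 ‖p.2‖ :=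
    (continuous_wgt cs).comp (f := fun p : ℝ × E3 => (p.1, ‖p.2‖)) (by fun_prop)
  have hj : Continuous fun p : ℝ × E3 => jb (p.1 + ‖p.2‖) ^ κ :=
    (continuous_jb_rpow κ).comp (f := fun p : ℝ × E3 => p.1 + ‖p.2‖) (by fun_prop)
  have hf : Continuous fun p : ℝ × E3 =>
      ‖p.2‖ * jb (p.1 + ‖p.2‖) ^ κ * wgt cs p.1 ‖p.2‖ ^ (1 + μ) * vnorm s G p.1 p.2 :=
    (((continuous_norm.comp continuous_snd).mul hj).mul
      (hw.rpow_const fun p => Or.inl (wgt_pos _ _ _).ne')).mul (continuous_vnorm hG s)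
  refine (hK.image hf).bddAbove.mono ?_
  rintro a ⟨σ, z, h1, h2, h3, rfl⟩
  refine ⟨(σ, z), ⟨⟨h1, h2⟩, ?_⟩, rfl⟩
  rw [mem_closedBall_iff_norm]
  linarith

lemma Afun_nonneg {N : ℕ} (cs : Fin N → ℝ) (κ μ : ℝ) (s : ℕ) (G : Fn) (t : ℝ) (x : E3) :
    0 ≤ Afun κ μ s G 1 cs t x := by
  refine Real.sSup_nonneg ?_
  rintro a ⟨τ, y, -, -, -, rfl⟩
  have h1 := jb_rpow_nonneg (τ + ‖y‖) κ
  have h2 := (wgt_pos cs τ ‖y‖).le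
  have h3 := vnorm_nonneg s G τ y
  positivity

/-- Pointwise control of the source by the weighted supremum. -/
lemma norm_mul_le_Afun {N : ℕ} (cs : Fin N → ℝ) (κ μ : ℝ) {s : ℕ} {G : Fn} (hG : Smooth G)
    {t τ : ℝ} {x y : E3} (hτ : 0 ≤ τ) (hτt : τ ≤ t) (hy : ‖y - x‖ ≤ t - τ) {a : ℝ}
    (ha : a ≤ vnorm s G τ y) :
    ‖y‖ * a ≤ Afun κ μ s G 1 cs t x * jb (τ + ‖y‖) ^ (-κ) * wsum cs (1 + μ) τ ‖y‖ := by
  have h := le_Afun cs κ μ (s := s) hG hτ hτt hy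
  have hj := Real.rpow_pos_of_pos (jb_pos (τ + ‖y‖)) κ
  have hw := Real.rpow_pos_of_pos (wgt_pos cs τ ‖y‖) (1 + μ)
  have hA := Afun_nonneg cs κ μ s G t x
  calc ‖y‖ * a ≤ ‖y‖ * vnorm s G τ y := by gcongr
    _ = (‖y‖ * jb (τ + ‖y‖) ^ κ * wgt cs τ ‖y‖ ^ (1 + μ) * vnorm s G τ y) *
        jb (τ + ‖y‖) ^ (-κ) * wgt cs τ ‖y‖ ^ (-(1 + μ)) := by
      rw [Real.rpow_neg (jb_pos _).le, Real.rpow_neg (wgt_pos _ _ _).le]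
      field_simp
    _ ≤ _ := by
      have := jb_rpow_nonneg (τ + ‖y‖) (-κ)
      have h2 := Real.rpow_nonneg (wgt_pos cs τ ‖y‖).le (-(1 + μ))
      have h3 := wgt_rpow_neg_le cs (1 + μ) τ ‖y‖
      gcongr

lemma jb_rpow_neg_le {κ : ℝ} (hκ : κ ≤ 2) {p T : ℝ} (hp : 0 ≤ p) (hpT : p ≤ T) :
    jb p ^ (-κ) ≤ jb T ^ (2 - κ) * (1 + p ^ 2)⁻¹ := by
  have h1 : jb p ^ (2 - κ) ≤ jb T ^ (2 - κ) :=
    Real.rpow_le_rpow (jb_pos _).le (jb_le_jb hp hpT) (by linarith)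
  rw [← jb_sq, ← Real.rpow_natCast, ← Real.rpow_neg (jb_pos _).le]
  calc jb p ^ (-κ) = jb p ^ (2 - κ) * jb p ^ (-((2 : ℕ) : ℝ)) := by
        rw [← Real.rpow_add (jb_pos _)]; congr 1; push_cast; ring
    _ ≤ _ := by
        have := jb_rpow_nonneg p (-((2 : ℕ) : ℝ))
        gcongr

/-- Decay of the twice rotated solution along the ray through `(t, r • w)`. -/
lemma abs_rot_rot_le {N : ℕ} {cs : Fin N → ℝ} (hcs : ∀ j, 0 < cs j) {κ μ : ℝ} (hκ : κ ≤ 2)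
    (hμ : 0 < μ) {G u : Fn} (hG : Smooth G) (h : IsWaveSol 1 G u) {t r ρ : ℝ} {w : E3}
    (hr : 0 < r) (hw : ‖w‖ = 1) (hrρ : r ≤ ρ) (hρ : ρ ≤ t + r) (j k : Fin 3)
    (hjk : ∀ s z, |rotA j k (rotA j k G) s z| ≤ vnorm 2 G s z) :
    |rot j k (rot j k (un u)) (t + r - ρ, ρ • w)| ≤
      jb (t + r) ^ (2 - κ) * Afun κ μ 2 G 1 cs t (r • w) * ((N + 1) * jbInt (1 + μ)) *
        (16 * ρ / (t + r) ^ 2) * (ρ⁻¹ + (1 + |t + r - 2 * ρ|)⁻¹) := by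
  have hF : ContDiff ℝ ∞ (un u) := h.1
  obtain ⟨h0, h1⟩ := initial_data h
  have hρ0 : 0 < ρ := hr.trans_le hrρ
  have hn : ‖ρ • w‖ = ρ := by rw [norm_smul, hw, Real.norm_eq_abs, abs_of_pos hρ0, mul_one]
  have hA := Afun_nonneg cs κ μ 2 G t (r • w)
  have hT := jb_rpow_nonneg (t + r) (2 - κ)
  have key := abs_le_of_weighted_source (t := t + r - ρ) (y := ρ • w)
    (M := jb (t + r) ^ (2 - κ) * Afun κ μ 2 G 1 cs t (r • w)) hcs (by linarith : 1 < 1 + μ)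
    (contDiff_rot (contDiff_rot hF j k) j k)
    (rot_initial_eq_zero (contDiff_rot hF j k) (rot_initial_eq_zero hF h0 j k) j k)
    (rot_initial_deriv_eq_zero (contDiff_rot hF j k) (rot_initial_deriv_eq_zero hF h1 j k) j k)
    (by linarith) (norm_pos_iff.1 (hρ0.trans_eq hn.symm)) (mul_nonneg hT hA) ?_
  · rwa [hn, sub_add_cancel] at key
  · intro s z hs hz
    have hd : ‖ρ • w - r • w‖ = ρ - r := by
      rw [← sub_smul, norm_smul, hw, Real.norm_eq_abs, abs_of_nonneg (by linarith), mul_one]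
    have hzr : ‖z - r • w‖ ≤ t - s := by
      have := norm_sub_le_norm_sub_add_norm_sub z (ρ • w) (r • w)
      linarith
    have hzT : s + ‖z‖ ≤ t + r := by
      have h2 := norm_le_norm_add_norm_sub' z (r • w)
      rw [norm_smul, hw, Real.norm_eq_abs, abs_of_pos hr] at h2
      linarith
    have hst : s ≤ t := by linarith [norm_nonneg (z - r • w)]
    rw [box_rot_rot_un_eq hG h j k hs]
    refine (norm_mul_le_Afun cs κ μ hG hs.le hst hzr (hjk s z)).trans ?_
    have h3 := jb_rpow_neg_le hκ (by positivity) hzT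
    have h4 := wsum_nonneg cs (1 + μ) s ‖z‖
    calc _ ≤ Afun κ μ 2 G 1 cs t (r • w) * (jb (t + r) ^ (2 - κ) * (1 + (s + ‖z‖) ^ 2)⁻¹) *
          wsum cs (1 + μ) s ‖z‖ := by gcongr
      _ = _ := by ring

/-- Pointwise bound for the derivative of the outgoing quantity along the ray. -/
lemma abs_rayQ'_le {N : ℕ} {cs : Fin N → ℝ} (hcs : ∀ j, 0 < cs j) {κ μ : ℝ} (hκ : κ ≤ 2)
    (hμ : 0 < μ) {G u : Fn} (hG : Smooth G) (h : IsWaveSol 1 G u) {t r ρ : ℝ} {w : E3}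
    (hr : 0 < r) (hw : ‖w‖ = 1) (hrρ : r ≤ ρ) (hρ : ρ < t + r) :
    |rayQ' (un u) (t + r) 0 w ρ| ≤
      Afun κ μ 2 G 1 cs t (r • w) * jb (t + r) ^ (-κ) * wsum cs (1 + μ) (t + r - ρ) ρ +
      jb (t + r) ^ (2 - κ) * Afun κ μ 2 G 1 cs t (r • w) * ((N + 1) * jbInt (1 + μ)) *
        (48 / (t + r) ^ 2) * (ρ⁻¹ + (1 + |t + r - 2 * ρ|)⁻¹) := by
  have hρ0 : 0 < ρ := hr.trans_le hrρ
  have hn : ‖ρ • w‖ = ρ := by rw [norm_smul, hw, Real.norm_eq_abs, abs_of_pos hρ0, mul_one]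
  have hd : ‖ρ • w - r • w‖ = ρ - r := by
    rw [← sub_smul, norm_smul, hw, Real.norm_eq_abs, abs_of_nonneg (by linarith), mul_one]
  have hF : ContDiff ℝ ∞ (un u) := h.1
  rw [rayQ'_eq hF _ hρ0.ne' hw, abs_neg, box_un_eq h (by linarith)]
  refine (abs_add_le _ _).trans (add_le_add ?_ ?_)
  · rw [abs_mul, abs_of_pos hρ0]
    have := norm_mul_le_Afun cs κ μ (τ := t + r - ρ) (y := ρ • w) (x := r • w) (t := t) hG
      (by linarith) (by linarith) (by linarith) (abs_le_vnorm_two G _ _)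
    rwa [hn, sub_add_cancel] at this
  · have e := fun j k hjk =>
      abs_rot_rot_le (κ := κ) hcs hκ hμ hG h hr hw hrρ hρ.le j k hjk
    have e1 := e 0 1 fun s z => (abs_rotA_rotA_le_vnorm_two G s z).1
    have e2 := e 0 2 fun s z => (abs_rotA_rotA_le_vnorm_two G s z).2.1
    have e3 := e 1 2 fun s z => (abs_rotA_rotA_le_vnorm_two G s z).2.2
    rw [abs_mul, abs_of_pos (inv_pos.2 hρ0)]
    have e4 := (abs_add_three _ _ _).trans (add_le_add (add_le_add e1 e2) e3)
    have := mul_le_mul_of_nonneg_left e4 (inv_pos.2 hρ0).le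
    refine this.trans (le_of_eq ?_)
    have : t + r ≠ 0 := by linarith
    field_simp
    ring

lemma integral_wsum_ray_le {N : ℕ} {cs : Fin N → ℝ} (hcs : ∀ j, 0 < cs j) {ν : ℝ}
    (hν : 1 < ν) {r T : ℝ} (hrT : r ≤ T) :
    ∫ ρ in r..T, wsum cs ν (T - ρ) ρ ≤ (N + 1) * jbInt ν := by
  have := intervalIntegral.integral_comp_sub_left (a := r) (b := T)
    (fun s => wsum cs ν s (T - s)) T
  simp only [sub_sub_cancel, sub_self] at this
  rw [this]
  exact integral_wsum_incoming_le hcs hν T (by linarith)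

lemma abs_rayQ_le {N : ℕ} {cs : Fin N → ℝ} (hcs : ∀ j, 0 < cs j) {κ μ : ℝ} (hκ : κ ≤ 2)
    (hμ : 0 < μ) {G u : Fn} (hG : Smooth G) (h : IsWaveSol 1 G u) {t r : ℝ} {w : E3}
    (ht : 0 < t) (hr : 1 ≤ r) (hw : ‖w‖ = 1) :
    |rayQ (un u) (t + r) 0 w r| ≤
      Afun κ μ 2 G 1 cs t (r • w) * jb (t + r) ^ (-κ) * ((N + 1) * jbInt (1 + μ)) +
      jb (t + r) ^ (2 - κ) * Afun κ μ 2 G 1 cs t (r • w) * ((N + 1) * jbInt (1 + μ)) *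
        (48 / (t + r) ^ 2) * (2 * log (2 + (t + r))) := by
  obtain ⟨h0, h1⟩ := initial_data h
  have hrT : r ≤ t + r := by linarith
  have hA := Afun_nonneg cs κ μ 2 G t (r • w)
  have hT := jb_rpow_nonneg (t + r) (2 - κ)
  have hT' := jb_rpow_nonneg (t + r) (-κ)
  have hB := jbInt_nonneg (1 + μ)
  have c1 : Continuous fun ρ => |rayQ' (un u) (t + r) 0 w ρ| :=
    ((continuous_rayQ' h.1 (t + r) 0).comp (f := fun ρ => (ρ, w)) (by fun_prop)).abs
  have c2 : Continuous fun ρ => Afun κ μ 2 G 1 cs t (r • w) * jb (t + r) ^ (-κ) *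
      wsum cs (1 + μ) (t + r - ρ) ρ :=
    continuous_const.mul ((continuous_wsum cs (1 + μ)).comp (f := fun ρ => (t + r - ρ, ρ))
      (by fun_prop))
  have c3 : ContinuousOn (fun ρ : ℝ => ρ⁻¹ + (1 + |t + r - 2 * ρ|)⁻¹) (Set.Icc r (t + r)) :=
    (continuousOn_id.inv₀ fun ρ hρ => (show (0 : ℝ) < ρ by linarith [hρ.1]).ne').add
      (continuous_inv_one_add_abs.comp
        (by fun_prop : Continuous fun ρ : ℝ => t + r - 2 * ρ)).continuousOn
  have i2 := c2.intervalIntegrable (μ := volume) r (t + r)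
  have i3 : IntervalIntegrable (fun ρ => jb (t + r) ^ (2 - κ) * Afun κ μ 2 G 1 cs t (r • w) *
      ((N + 1) * jbInt (1 + μ)) * (48 / (t + r) ^ 2) * (ρ⁻¹ + (1 + |t + r - 2 * ρ|)⁻¹))
      volume r (t + r) :=
    (continuousOn_const.mul c3).intervalIntegrable_of_Icc hrT
  have hF : ContDiff ℝ ∞ (un u) := h.1
  rw [rayQ_eq_integral hF h0 h1, abs_neg]
  refine (intervalIntegral.abs_integral_le_integral_abs hrT).trans ?_
  refine (intervalIntegral.integral_mono_on_of_le_Ioo hrT (c1.intervalIntegrable _ _)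
    (i2.add i3) fun ρ hρ =>
      abs_rayQ'_le (κ := κ) hcs hκ hμ hG h (by linarith) hw hρ.1.le hρ.2).trans ?_
  rw [intervalIntegral.integral_add i2 i3, intervalIntegral.integral_const_mul,
    intervalIntegral.integral_const_mul]
  have e1 := integral_wsum_ray_le hcs (by linarith : 1 < 1 + μ) hrT
  have e2 := integral_log_kernel_le hr hrT
  gcongr

end Aux

theorem stmt15 {N : ℕ} (cs : Fin N → ℝ) (hcs : ∀ j, 0 < cs j)
    (κ μ : ℝ) (hκ1 : 1 ≤ κ) (hκ2 : κ ≤ 2) (hμ : 0 < μ) :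
    ∃ C > (0 : ℝ), ∀ G u : Fn, Smooth G → IsWaveSol 1 G u →
      ∀ (t r : ℝ) (ω : E3), 0 < t → 1 ≤ r → ‖ω‖ = 1 →
        |deriv (fun s' => Vrad u ω s' r) t + deriv (fun ρ' => Vrad u ω t ρ') r| ≤
          C * jb (t + r) ^ (-κ) * Real.log (2 + t + r) * Afun κ μ 2 G 1 cs t (r • ω) := by
  have hB := jbInt_nonneg (1 + μ)
  refine ⟨193 * ((N + 1) * jbInt (1 + μ)) + 1, by positivity, ?_⟩
  intro G u hG h t r ω ht hr hω
  rw [deriv_Vrad_add_deriv_Vrad h.1]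
  refine (abs_rayQ_le (κ := κ) hcs hκ2 hμ hG h ht hr hω).trans ?_
  have hA := Afun_nonneg cs κ μ 2 G t (r • ω)
  have hj := jb_rpow_nonneg (t + r) (-κ)
  have hlog : 1 ≤ Real.log (2 + (t + r)) := by
    rw [Real.le_log_iff_exp_le (by linarith)]
    linarith [Real.exp_one_lt_d9]
  have hsplit : jb (t + r) ^ (2 - κ) * (48 / (t + r) ^ 2) ≤ 96 * jb (t + r) ^ (-κ) := by
    have e : jb (t + r) ^ (2 - κ) = (1 + (t + r) ^ 2) * jb (t + r) ^ (-κ) := by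
      rw [← jb_sq, ← Real.rpow_natCast, ← Real.rpow_add (jb_pos _)]
      congr 1
    have h2 : (1 + (t + r) ^ 2) * (48 / (t + r) ^ 2) ≤ 96 := by
      have : 1 ≤ t + r := by linarith
      rw [← mul_div_assoc, div_le_iff₀ (by positivity)]
      nlinarith
    rw [e, mul_right_comm]
    gcongr
  rw [show 2 + t + r = 2 + (t + r) by ring]
  generalize Afun κ μ 2 G 1 cs t (r • ω) = A at *
  generalize jb (t + r) ^ (-κ) = J at *
  generalize Real.log (2 + (t + r)) = L at *
  set B : ℝ := (N + 1) * jbInt (1 + μ) with hBdef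
  have hB' : 0 ≤ B := by positivity
  have hL : 0 ≤ L := by linarith
  calc _ = A * J * B + jb (t + r) ^ (2 - κ) * (48 / (t + r) ^ 2) * (A * B * (2 * L)) := by ring
    _ ≤ A * J * B * L + 96 * J * (A * B * (2 * L)) := by
        refine add_le_add (le_mul_of_one_le_right (by positivity) hlog) ?_
        gcongr
    _ = 193 * B * J * L * A := by ring
    _ ≤ _ := by
        gcongr
        linarith

end PaperKatayama
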